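/- Let M be a von Neumann algebra and suppose {x_α} is a uniformly bounded net of n-divisible elements converging σ-strong* to x. Then every element of W*(x) is a σ-strong* limit of n-divisible elements. -/

import Mathlib

open Filter

/-- `z` is `n`-divisible in the von Neumann algebra `M`: the relative commutant
`W*(z)' ∩ M` unitally contains a type `I_n` factor. -/
def NDivisible {H : Type*} [NormedAddCommGroup H] [InnerProductSpace ℂ H] [CompleteSpace H]
    (M : VonNeumannAlgebra H) (n : ℕ) (z : H →L[ℂ] H) : Prop :=
  ∃ φ : Matrix (Fin n) (Fin n) ℂ →⋆ₐ[ℂ] (H →L[ℂ] H),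
    (∀ T, φ T ∈ M) ∧ ∀ T, Commute (φ T) z

/-- σ-strong convergence of a net, via the ℓ²-vector seminorms
`z ↦ (Σ_i ‖z ξ_i‖²)^{1/2}`. -/
def SigmaStrongTendsto {H : Type*} [NormedAddCommGroup H] [InnerProductSpace ℂ H]
    {ι : Type*} (l : Filter ι) (zs : ι → H →L[ℂ] H) (z : H →L[ℂ] H) : Prop :=
  ∀ ξ : ℕ → H, Summable (fun i => ‖ξ i‖ ^ 2) →
    Tendsto (fun α => ∑' i, ‖zs α (ξ i) - z (ξ i)‖ ^ 2) l (nhds 0)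

namespace Divisible

open ContinuousLinearMap

variable {H : Type*} [NormedAddCommGroup H] [InnerProductSpace ℂ H] [CompleteSpace H]

theorem mem_of_commute {M : VonNeumannAlgebra H} {a : H →L[ℂ] H}
    (h : ∀ T ∈ M.commutant, T * a = a * T) : a ∈ M := by
  rw [← M.commutant_commutant]
  exact VonNeumannAlgebra.mem_commutant_iff.2 h

theorem commute_of_mem {M : VonNeumannAlgebra H} {a T : H →L[ℂ] H} (ha : a ∈ M)
    (hT : T ∈ M.commutant) : T * a = a * T :=
  (VonNeumannAlgebra.mem_commutant_iff.1 hT a ha).symm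

omit [CompleteSpace H] in
theorem clm_mul_apply (a b : H →L[ℂ] H) (v : H) : (a * b) v = a (b v) := rfl

theorem smul_mem {M : VonNeumannAlgebra H} (c : ℂ) {a : H →L[ℂ] H} (ha : a ∈ M) : c • a ∈ M :=
  M.toStarSubalgebra.smul_mem ha c

theorem inner_star_left (a : H →L[ℂ] H) (v w : H) :
    inner ℂ (star a v) w = inner ℂ v (a w) := by
  rw [star_eq_adjoint, adjoint_inner_left]

theorem inner_star_right (a : H →L[ℂ] H) (v w : H) :
    inner ℂ v (star a w) = inner ℂ (a v) w := by
  rw [star_eq_adjoint, adjoint_inner_right]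

theorem apply_eq_zero_of_star_mul {a : H →L[ℂ] H} {v : H} (h : (star a * a) v = 0) : a v = 0 := by
  rw [← inner_self_eq_zero (𝕜 := ℂ), ← inner_star_left, ← clm_mul_apply, h, inner_zero_left]

theorem eq_zero_of_star_mul {a : H →L[ℂ] H} (h : star a * a = 0) : a = 0 := by
  ext v
  exact apply_eq_zero_of_star_mul (by simp [h])

theorem hasSum_mem {M : VonNeumannAlgebra H} {I : Type*} {a : I → H →L[ℂ] H} {s : H →L[ℂ] H}
    (ha : ∀ i, a i ∈ M) (hs : ∀ v, HasSum (fun i => a i v) (s v)) : s ∈ M := by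
  refine mem_of_commute fun T hT => ?_
  ext v
  refine ((hs v).mapL T).unique ?_
  have := hs (T v)
  simpa only [← clm_mul_apply, ← commute_of_mem (ha _) hT] using this

omit [CompleteSpace H] in
theorem norm_sq_sum_of_orthogonal {I : Type*} (f : I → H)
    (ho : ∀ i j, i ≠ j → inner ℂ (f i) (f j) = 0) (s : Finset I) :
    ‖∑ i ∈ s, f i‖ ^ 2 = ∑ i ∈ s, ‖f i‖ ^ 2 := by
  have : (inner ℂ (∑ i ∈ s, f i) (∑ i ∈ s, f i) : ℂ) = ∑ i ∈ s, inner ℂ (f i) (f i) := by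
    rw [sum_inner]
    refine Finset.sum_congr rfl fun i hi => ?_
    rw [inner_sum, Finset.sum_eq_single i]
    · intro j _ hj
      exact ho i j hj.symm
    · exact fun h => absurd hi h
  simp only [inner_self_eq_norm_sq_to_K] at this
  exact_mod_cast this

theorem summable_of_orthogonal {I : Type*} (f : I → H)
    (ho : ∀ i j, i ≠ j → inner ℂ (f i) (f j) = 0) (C : ℝ)
    (hC : ∀ s : Finset I, ∑ i ∈ s, ‖f i‖ ^ 2 ≤ C) : Summable f := by
  have h1 : Summable fun i => ‖f i‖ ^ 2 := summable_of_sum_le (fun i => sq_nonneg _) hC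
  rw [summable_iff_vanishing_norm] at h1 ⊢
  intro ε hε
  obtain ⟨s, hs⟩ := h1 (ε ^ 2) (by positivity)
  refine ⟨s, fun t ht => ?_⟩
  have := hs t ht
  rw [← norm_sq_sum_of_orthogonal f ho, Real.norm_of_nonneg (by positivity)] at this
  exact lt_of_pow_lt_pow_left₀ 2 hε.le this

theorem sum_norm_sq_projection_le {I : Type*} (E : I → H →L[ℂ] H)
    (hE : ∀ i, IsStarProjection (E i)) (hEo : ∀ i j, i ≠ j → E i * E j = 0) (v : H)
    (s : Finset I) : ∑ i ∈ s, ‖E i v‖ ^ 2 ≤ ‖v‖ ^ 2 := by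
  have ho : ∀ i j, i ≠ j → inner ℂ (E i v) (E j v) = 0 := by
    intro i j hij
    rw [← inner_star_right, (hE i).isSelfAdjoint.star_eq, ← clm_mul_apply, hEo i j hij]
    simp
  have h1 := norm_sq_sum_of_orthogonal (fun i => E i v) ho s
  rw [← h1]
  have h2 : inner ℂ (∑ i ∈ s, E i v) (v - ∑ i ∈ s, E i v) = 0 := by
    rw [sum_inner]
    refine Finset.sum_eq_zero fun i hi => ?_
    rw [← inner_star_right, (hE i).isSelfAdjoint.star_eq, map_sub, map_sum,
      Finset.sum_eq_single i]
    · rw [← clm_mul_apply, (hE i).isIdempotentElem.eq, sub_self, inner_zero_right]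
    · intro j _ hj
      rw [← clm_mul_apply, hEo i j hj.symm]
      simp
    · exact fun h => absurd hi h
  have h3 := norm_add_sq_eq_norm_sq_add_norm_sq_of_inner_eq_zero _ _ h2
  rw [add_sub_cancel] at h3
  nlinarith [mul_self_nonneg ‖v - ∑ i ∈ s, E i v‖]

theorem exists_hasSum_of_orthogonal {I : Type*} (a E : I → H →L[ℂ] H) {C : ℝ} (hC : 0 ≤ C)
    (hE : ∀ i, IsStarProjection (E i)) (hEo : ∀ i j, i ≠ j → E i * E j = 0)
    (haE : ∀ i, a i * E i = a i) (hao : ∀ i j, i ≠ j → star (a i) * a j = 0)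
    (hn : ∀ i, ‖a i‖ ≤ C) :
    ∃ s : H →L[ℂ] H, ‖s‖ ≤ C ∧ ∀ v, HasSum (fun i => a i v) (s v) := by
  have ho : ∀ v i j, i ≠ j → inner ℂ (a i v) (a j v) = 0 := by
    intro v i j hij
    rw [← inner_star_right, ← clm_mul_apply, hao i j hij]
    simp
  have hb : ∀ v (s : Finset I), ∑ i ∈ s, ‖a i v‖ ^ 2 ≤ (C * ‖v‖) ^ 2 := by
    intro v s
    calc ∑ i ∈ s, ‖a i v‖ ^ 2 ≤ ∑ i ∈ s, C ^ 2 * ‖E i v‖ ^ 2 := by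
          refine Finset.sum_le_sum fun i _ => ?_
          rw [← mul_pow]
          gcongr
          conv_lhs => rw [← haE i, clm_mul_apply]
          exact (a i).le_of_opNorm_le (hn i) _
      _ ≤ (C * ‖v‖) ^ 2 := by
          rw [← Finset.mul_sum, mul_pow]
          gcongr
          exact sum_norm_sq_projection_le E hE hEo v s
  have hs : ∀ v, Summable fun i => a i v := fun v => summable_of_orthogonal _ (ho v) _ (hb v)
  have hbd : ∀ v, ‖∑' i, a i v‖ ≤ C * ‖v‖ := by
    intro v
    refine le_of_tendsto (hs v).hasSum.norm (.of_forall fun s => ?_)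
    refine le_of_sq_le_sq ?_ (by positivity)
    rw [norm_sq_sum_of_orthogonal _ (ho v)]
    exact hb v s
  refine ⟨LinearMap.mkContinuous
    { toFun := fun v => ∑' i, a i v
      map_add' := fun v w => by simp only [map_add]; exact (hs v).tsum_add (hs w)
      map_smul' := fun c v => by simp only [map_smul]; exact (hs v).tsum_const_smul c } C hbd,
    LinearMap.mkContinuous_norm_le _ hC _, fun v => (hs v).hasSum⟩

/-- Strong sums of uniformly bounded families with orthogonal supports and ranges. -/
theorem exists_hasSum {I : Type*} (a E F : I → H →L[ℂ] H) {C : ℝ} (hC : 0 ≤ C)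
    (hE : ∀ i, IsStarProjection (E i)) (hEo : ∀ i j, i ≠ j → E i * E j = 0)
    (hF : ∀ i, IsStarProjection (F i)) (hFo : ∀ i j, i ≠ j → F i * F j = 0)
    (haE : ∀ i, a i * E i = a i) (haF : ∀ i, F i * a i = a i) (hn : ∀ i, ‖a i‖ ≤ C) :
    ∃ s : H →L[ℂ] H, ‖s‖ ≤ C ∧ (∀ v, HasSum (fun i => a i v) (s v)) ∧
      ∀ v, HasSum (fun i => star (a i) v) (star s v) := by
  have haF' : ∀ i, star (a i) * F i = star (a i) := fun i => by
    have := congrArg star (haF i)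
    rwa [star_mul, (hF i).isSelfAdjoint.star_eq] at this
  have haE' : ∀ i, E i * star (a i) = star (a i) := fun i => by
    have := congrArg star (haE i)
    rwa [star_mul, (hE i).isSelfAdjoint.star_eq] at this
  obtain ⟨s, hsn, hs⟩ := exists_hasSum_of_orthogonal a E hC hE hEo haE (fun i j hij => by
    rw [← haF j, ← haF' i, mul_assoc, ← mul_assoc (F i), hFo i j hij]; simp) hn
  obtain ⟨t, _, ht⟩ := exists_hasSum_of_orthogonal (fun i => star (a i)) F hC hF hFo haF'
    (fun i j hij => by
      rw [star_star, ← haE i, ← haE' j, mul_assoc, ← mul_assoc (E i), hEo i j hij]; simp)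
    (fun i => by rw [norm_star]; exact hn i)
  have hst : star s = t := by
    ext v
    refine ext_inner_right ℂ fun w => ?_
    rw [inner_star_left]
    have h1 := (hs w).mapL (innerSL ℂ v)
    have h2 : HasSum (fun i => inner ℂ (star (a i) v) w) (inner ℂ (t v) w) := by
      have := ((ht v).mapL (innerSL ℂ w)).star
      simpa using this
    simp only [inner_star_left] at h2
    exact h1.unique h2
  exact ⟨s, hsn, hs, fun v => hst ▸ ht v⟩

theorem exists_maximal_pairwise {α : Type*} (p : α → Prop) (r : α → α → Prop) :
    ∃ S : Set α, (∀ a ∈ S, p a) ∧ S.Pairwise r ∧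
      ∀ b, p b → (∀ a ∈ S, r a b ∧ r b a) → b ∈ S := by
  obtain ⟨S, hS⟩ := zorn_subset {S : Set α | (∀ a ∈ S, p a) ∧ S.Pairwise r} (fun c hc hcc => by
    refine ⟨⋃₀ c, ⟨?_, ?_⟩, fun s hs => Set.subset_sUnion_of_mem hs⟩
    · rintro a ⟨s, hs, ha⟩
      exact (hc hs).1 a ha
    · exact (Set.pairwise_sUnion hcc.directedOn).2 fun s hs => (hc hs).2)
  refine ⟨S, hS.prop.1, hS.prop.2, fun b hb hr => ?_⟩
  have : insert b S ⊆ S := hS.le_of_ge (y := insert b S) ⟨?_, ?_⟩ (Set.subset_insert _ _)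
  · exact this (Set.mem_insert _ _)
  · rintro a (rfl | ha)
    · exact hb
    · exact hS.prop.1 a ha
  · exact hS.prop.2.insert fun a ha _ => ⟨(hr a ha).2, (hr a ha).1⟩

theorem isStarProjection_star_mul {u : H →L[ℂ] H} (hu : u * star u * u = u) :
    IsStarProjection (star u * u) :=
  ⟨by rw [IsIdempotentElem, mul_assoc, ← mul_assoc u, hu], IsSelfAdjoint.star_mul_self u⟩

theorem star_partialIsometry {u : H →L[ℂ] H} (hu : u * star u * u = u) :
    star u * star (star u) * star u = star u := by
  have := congrArg star hu
  simpa [mul_assoc] using this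

theorem isStarProjection_mul_star {u : H →L[ℂ] H} (hu : u * star u * u = u) :
    IsStarProjection (u * star u) := by
  simpa using isStarProjection_star_mul (star_partialIsometry hu)

theorem norm_le_one_of_isStarProjection {p : H →L[ℂ] H} (hp : IsStarProjection p) : ‖p‖ ≤ 1 := by
  obtain ⟨_, h⟩ := isStarProjection_iff_eq_starProjection_range.1 hp
  rw [h]
  exact Submodule.starProjection_norm_le _

theorem norm_le_one_of_partialIsometry {u : H →L[ℂ] H} (hu : u * star u * u = u) : ‖u‖ ≤ 1 := by
  have h := norm_le_one_of_isStarProjection (isStarProjection_star_mul hu)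
  rw [CStarRing.norm_star_mul_self] at h
  nlinarith [norm_nonneg u]

/-- Strong sums of partial isometries with orthogonal supports and orthogonal ranges. -/
theorem exists_sum_partialIsometry {M : VonNeumannAlgebra H} {I : Type*} (u : I → H →L[ℂ] H)
    (hM : ∀ i, u i ∈ M) (hu : ∀ i, u i * star (u i) * u i = u i)
    (h1 : ∀ i j, i ≠ j → star (u i) * u j = 0) (h2 : ∀ i j, i ≠ j → u i * star (u j) = 0) :
    ∃ s ∈ M, s * star s * s = s ∧ (∀ i, star (u i) * s = star (u i) * u i) ∧
      (∀ i, s * star (u i) = u i * star (u i)) ∧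
      (∀ b, (∀ i, u i * b = 0) → s * b = 0) ∧ (∀ b, (∀ i, b * u i = 0) → b * s = 0) := by
  obtain ⟨s, -, hs, -⟩ := exists_hasSum u (fun i => star (u i) * u i) (fun i => u i * star (u i))
    zero_le_one (fun i => isStarProjection_star_mul (hu i))
    (fun i j hij => by rw [mul_assoc, ← mul_assoc (u i), h2 i j hij]; simp)
    (fun i => isStarProjection_mul_star (hu i))
    (fun i j hij => by rw [mul_assoc, ← mul_assoc (star (u i)), h1 i j hij]; simp)
    (fun i => by rw [← mul_assoc, hu]) (fun i => hu i)
    (fun i => norm_le_one_of_partialIsometry (hu i))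
  have hA : ∀ i, star (u i) * s = star (u i) * u i := by
    intro i
    ext v
    have h := (hs v).mapL (star (u i))
    refine h.unique ?_
    simp only [← clm_mul_apply]
    refine hasSum_single i fun j hj => ?_
    rw [h1 i j hj.symm]
    rfl
  have hB : ∀ i, s * star (u i) = u i * star (u i) := by
    intro i
    ext v
    refine (hs (star (u i) v)).unique ?_
    simp only [← clm_mul_apply]
    refine hasSum_single i fun j hj => ?_
    rw [h2 j i hj]
    rfl
  have hC : ∀ b, (∀ i, u i * b = 0) → s * b = 0 := by
    intro b hb
    ext v
    refine (hs (b v)).unique ?_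
    simp only [← clm_mul_apply, hb]
    exact hasSum_zero
  refine ⟨s, hasSum_mem hM hs, ?_, hA, hB, hC, ?_⟩
  · have := hC (star s * s - 1) fun i => by
      have h := congrArg star (hB i)
      rw [star_mul, star_mul, star_star] at h
      rw [mul_sub, ← mul_assoc, h, mul_assoc, hA, ← mul_assoc, hu, mul_one, sub_self]
    rw [mul_sub, mul_one, sub_eq_zero, ← mul_assoc] at this
    exact this
  · intro b hb
    ext v
    refine ((hs v).mapL b).unique ?_
    simp only [← clm_mul_apply, hb]
    exact hasSum_zero

/-- The projection onto the closed span of a set of vectors. -/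
theorem exists_projection (X : Set H) :
    ∃ q : H →L[ℂ] H, IsStarProjection q ∧ (∀ v ∈ X, q v = v) ∧
      (∀ c : H →L[ℂ] H, (∀ v ∈ X, c v = 0) → c * q = 0) ∧
      ∀ T : H →L[ℂ] H, (∀ v ∈ X, T v ∈ X) → (∀ v ∈ X, star T v ∈ X) → T * q = q * T := by
  set S : Submodule ℂ H := (Submodule.span ℂ X).topologicalClosure
  have : CompleteSpace S := (Submodule.isClosed_topologicalClosure _).completeSpace_coe
  have hX : ∀ v ∈ X, S.starProjection v = v := fun v hv =>
    Submodule.starProjection_eq_self_iff.2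
      (Submodule.le_topologicalClosure _ (Submodule.subset_span hv))
  have hc : ∀ c : H →L[ℂ] H, (∀ v ∈ X, c v = 0) → c * S.starProjection = 0 := by
    intro c hc
    have : S ≤ LinearMap.ker (c : H →ₗ[ℂ] H) :=
      Submodule.topologicalClosure_minimal _ (Submodule.span_le.2 fun v hv => hc v hv)
        c.isClosed_ker
    ext v
    exact this (Submodule.starProjection_apply_mem S v)
  have hsa : star S.starProjection = S.starProjection :=
    isStarProjection_starProjection.isSelfAdjoint.star_eq
  have hinv : ∀ T : H →L[ℂ] H, (∀ v ∈ X, T v ∈ X) →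
      T * S.starProjection = S.starProjection * T * S.starProjection := by
    intro T hT
    have := hc ((1 - S.starProjection) * T) fun v hv => by
      rw [clm_mul_apply, sub_apply, one_apply_eq_self, hX _ (hT v hv), sub_self]
    rwa [sub_mul, sub_mul, one_mul, sub_eq_zero] at this
  refine ⟨S.starProjection, isStarProjection_starProjection, hX, hc, fun T h1 h2 => ?_⟩
  have h3 := congrArg star (hinv (star T) h2)
  simp only [star_mul, star_star, hsa] at h3
  rw [h3, ← mul_assoc]
  exact hinv T h1

/-- Central supports of sets of vectors invariant under the commutant. -/
theorem exists_central_support (M : VonNeumannAlgebra H) (X : Set H)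
    (hX : ∀ T ∈ M.commutant, ∀ v ∈ X, T v ∈ X) :
    ∃ z ∈ M, z ∈ M.commutant ∧ IsStarProjection z ∧ (∀ v ∈ X, z v = v) ∧
      ∀ c : H →L[ℂ] H, (∀ a ∈ M, ∀ v ∈ X, c (a v) = 0) → c * z = 0 := by
  obtain ⟨z, hz, h1, h2, h3⟩ := exists_projection {w : H | ∃ a ∈ M, ∃ v ∈ X, w = a v}
  refine ⟨z, ?_, ?_, hz, ?_, ?_⟩
  · refine mem_of_commute fun T hT => h3 T ?_ ?_
    · rintro _ ⟨a, ha, v, hv, rfl⟩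
      exact ⟨a, ha, T v, hX T hT v hv, by
        rw [← clm_mul_apply, commute_of_mem ha hT, clm_mul_apply]⟩
    · rintro _ ⟨a, ha, v, hv, rfl⟩
      exact ⟨a, ha, star T v, hX _ (star_mem hT) v hv, by
        rw [← clm_mul_apply, commute_of_mem ha (star_mem hT), clm_mul_apply]⟩
  · refine VonNeumannAlgebra.mem_commutant_iff.2 fun b hb => h3 b ?_ ?_
    · rintro _ ⟨a, ha, v, hv, rfl⟩
      exact ⟨b * a, mul_mem hb ha, v, hv, rfl⟩
    · rintro _ ⟨a, ha, v, hv, rfl⟩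
      exact ⟨star b * a, mul_mem (star_mem hb) ha, v, hv, rfl⟩
  · intro v hv
    exact h1 v ⟨1, one_mem _, v, hv, rfl⟩
  · rintro c hc
    refine h2 c ?_
    rintro _ ⟨a, ha, v, hv, rfl⟩
    exact hc a ha v hv

/-- Polar decomposition inside a von Neumann algebra. -/
theorem exists_polar {M : VonNeumannAlgebra H} {a : H →L[ℂ] H} (ha : a ∈ M) :
    ∃ u ∈ M, u * star u * u = u ∧ (∀ b, u * b = 0 ↔ a * b = 0) ∧
      (∀ b, b * u = 0 ↔ b * a = 0) := by
  set S : H →L[ℂ] H := CFC.abs a with hS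
  have hSsa : star S = S := (CFC.abs_nonneg a).isSelfAdjoint.star_eq
  have hSS : S * S = star a * a := CFC.abs_mul_abs a
  have hnorm : ∀ v, ‖a v‖ = ‖S v‖ := by
    intro v
    have : (inner ℂ (a v) (a v) : ℂ) = inner ℂ (S v) (S v) := by
      rw [← inner_star_right, ← clm_mul_apply, ← inner_star_right, ← clm_mul_apply, hSsa, hSS]
    simp only [inner_self_eq_norm_sq_to_K] at this
    have h2 : ‖a v‖ ^ 2 = ‖S v‖ ^ 2 := by exact_mod_cast this
    exact (sq_eq_sq₀ (norm_nonneg _) (norm_nonneg _)).1 h2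
  set K : Submodule ℂ H := (LinearMap.range (S : H →ₗ[ℂ] H)).topologicalClosure with hK
  have : CompleteSpace K := (Submodule.isClosed_topologicalClosure _).completeSpace_coe
  have hSK : ∀ v, S v ∈ K := fun v => Submodule.le_topologicalClosure _ ⟨v, rfl⟩
  set e : H →ₗ[ℂ] K := (S : H →ₗ[ℂ] H).codRestrict K hSK with he
  have hdense : DenseRange e := by
    intro k
    rw [closure_subtype]
    have : (k : H) ∈ closure (LinearMap.range (S : H →ₗ[ℂ] H) : Set H) := k.2
    convert this
    ext w
    constructor
    · rintro ⟨_, ⟨v, rfl⟩, rfl⟩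
      exact ⟨v, rfl⟩
    · rintro ⟨v, rfl⟩
      exact ⟨e v, ⟨v, rfl⟩, rfl⟩
  set f : K →L[ℂ] H := (a : H →ₗ[ℂ] H).extendOfNorm e with hf
  have hfe : ∀ v, f (e v) = a v :=
    LinearMap.extendOfNorm_eq hdense ⟨1, fun v => by rw [one_mul]; exact (hnorm v).le⟩
  have hfn : ∀ k, ‖f k‖ = ‖k‖ := by
    intro k
    induction k using hdense.induction_on with
    | hp => exact isClosed_eq (by fun_prop) (by fun_prop)
    | ih v => exact (congrArg norm (hfe v)).trans (hnorm v)
  set u : H →L[ℂ] H := f.comp K.orthogonalProjectionOnto with hu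
  have huS : u * S = a := by
    ext v
    have : K.orthogonalProjectionOnto (S v) = e v :=
      Submodule.orthogonalProjectionOnto_mem_subspace_eq_self (e v)
    rw [clm_mul_apply, hu, comp_apply, this, hfe]
  set P : H →L[ℂ] H := K.starProjection with hP
  have hPsa : star P = P := isStarProjection_starProjection.isSelfAdjoint.star_eq
  have hPP : P * P = P := isStarProjection_starProjection.isIdempotentElem.eq
  have huP : u * P = u := by
    ext v
    have : K.orthogonalProjectionOnto (P v) = K.orthogonalProjectionOnto v :=
      Submodule.orthogonalProjectionOnto_mem_subspace_eq_self (K.orthogonalProjectionOnto v)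
    rw [clm_mul_apply, hu, comp_apply, this, comp_apply]
  have hPS : P * S = S := by
    ext v
    exact Submodule.starProjection_eq_self_iff.2 (hSK v)
  have hSP : S * P = S := by
    have := congrArg star hPS
    rwa [star_mul, hSsa, hPsa] at this
  have hc : ∀ c : H →L[ℂ] H, c * S = 0 → c * P = 0 := by
    intro c hc
    have : K ≤ LinearMap.ker (c : H →ₗ[ℂ] H) := by
      refine Submodule.topologicalClosure_minimal _ ?_ c.isClosed_ker
      rintro _ ⟨v, rfl⟩
      exact congrArg (fun f : H →L[ℂ] H => f v) hc
    ext v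
    exact this (Submodule.starProjection_apply_mem K v)
  have hstaru : star u * u = P := by
    refine ContinuousLinearMap.coe_injective ((ext_inner_map _ _).1 fun v => ?_)
    have h1 : (inner ℂ ((star u * u) v) v : ℂ) = inner ℂ (u v) (u v) := by
      rw [clm_mul_apply, inner_star_left]
    have h2 : (inner ℂ (P v) v : ℂ) = inner ℂ (P v) (P v) := by
      conv_rhs => rw [← inner_star_left, hPsa, ← clm_mul_apply, hPP]
    have h3 : ‖u v‖ = ‖P v‖ := hfn _
    refine h1.trans (Eq.trans ?_ h2.symm)
    rw [inner_self_eq_norm_sq_to_K, inner_self_eq_norm_sq_to_K, h3]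
  have hcomm : ∀ T ∈ M.commutant, T * S = S * T := fun T hT =>
    (Commute.cfcAbs_right (show Commute a T from (commute_of_mem ha hT).symm)
      (show Commute a (star T) from (commute_of_mem ha (star_mem hT)).symm))
  have hTP : ∀ T ∈ M.commutant, T * P = P * T * P := by
    intro T hT
    have := hc ((1 - P) * T) (by
      rw [mul_assoc, hcomm T hT, ← mul_assoc, sub_mul, hPS, one_mul, sub_self, zero_mul])
    rwa [sub_mul, sub_mul, one_mul, sub_eq_zero] at this
  refine ⟨u, mem_of_commute fun T hT => ?_, by rw [mul_assoc, hstaru, huP], fun b => ?_,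
    fun b => ?_⟩
  · have h1 := hc (T * u - u * T) (by
      rw [sub_mul, mul_assoc, mul_assoc, huS, hcomm T hT, ← mul_assoc, huS,
        commute_of_mem ha hT, sub_self])
    have h2 := congrArg star (hTP (star T) (star_mem hT))
    simp only [star_mul, star_star, hPsa] at h2
    rw [sub_mul, mul_assoc, huP, sub_eq_zero, mul_assoc, hTP T hT, mul_assoc, ← h2,
      ← mul_assoc, huP] at h1
    exact h1
  · constructor
    · intro h
      have h1 : P * b = 0 := by rw [← hstaru, mul_assoc, h, mul_zero]
      rw [← huS, ← hSP, mul_assoc, mul_assoc, h1, mul_zero, mul_zero]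
    · intro h
      have h1 : S * b = 0 := eq_zero_of_star_mul (by
        rw [star_mul, hSsa, mul_assoc, ← mul_assoc S, hSS, mul_assoc, h, mul_zero, mul_zero])
      have h2 := congrArg star (hc (star b) (by
        have := congrArg star h1
        rwa [star_mul, hSsa, star_zero] at this))
      rw [star_mul, hPsa, star_star, star_zero] at h2
      rw [← huP, mul_assoc, h2, mul_zero]
  · constructor
    · intro h
      rw [← huS, ← mul_assoc, h, zero_mul]
    · intro h
      have := hc (b * u) (by rw [mul_assoc, huS, h])
      rwa [mul_assoc, huP] at this

/-- A sequence of partial isometries in `M` with common support `e` and orthogonal ranges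
spanning the range of the projection `p`. -/
structure IsTower (M : VonNeumannAlgebra H) (t : ℕ → H →L[ℂ] H) (e p : H →L[ℂ] H) : Prop where
  mem : ∀ k, t k ∈ M
  proj : IsStarProjection e
  star_mul_self : ∀ k, star (t k) * t k = e
  ortho : ∀ j k, j ≠ k → star (t j) * t k = 0
  proj' : IsStarProjection p
  mem' : p ∈ M
  mul : ∀ k, p * t k = t k
  eq_zero : ∀ b : H →L[ℂ] H, (∀ k, b * t k = 0) → b * p = 0

/-- A tower whose zeroth term is its own support projection, without reference to the span. -/
structure IsSystem (M : VonNeumannAlgebra H) (u : ℕ → H →L[ℂ] H) : Prop where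
  mem : ∀ k, u k ∈ M
  star_mul_self : ∀ k, star (u k) * u k = u 0
  ortho : ∀ j k, j ≠ k → star (u j) * u k = 0

theorem mul_eq_self_of_star_mul {u e : H →L[ℂ] H} (he : IsStarProjection e)
    (h : star u * u = e) : u * e = u := by
  have h1 : u * (1 - e) = 0 := eq_zero_of_star_mul (by
    rw [star_mul, mul_assoc, ← mul_assoc (star u), h, mul_sub, mul_one,
      he.isIdempotentElem.eq, sub_self, mul_zero])
  rw [mul_sub, mul_one, sub_eq_zero] at h1
  exact h1.symm

theorem isStarProjection_of_star_mul_self {p : H →L[ℂ] H} (h : star p * p = p) :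
    IsStarProjection p := by
  have h1 : star p = p := by
    have := congrArg star h
    rw [star_mul, star_star, h] at this
    exact this.symm
  exact ⟨by rwa [h1] at h, h1⟩

namespace IsSystem

variable {M : VonNeumannAlgebra H} {u : ℕ → H →L[ℂ] H}

theorem proj (h : IsSystem M u) : IsStarProjection (u 0) :=
  isStarProjection_of_star_mul_self (h.star_mul_self 0)

theorem mul_first (h : IsSystem M u) (k : ℕ) : u k * u 0 = u k :=
  mul_eq_self_of_star_mul h.proj (h.star_mul_self k)

theorem partialIsometry (h : IsSystem M u) (k : ℕ) : u k * star (u k) * u k = u k := by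
  rw [mul_assoc, h.star_mul_self, h.mul_first]

end IsSystem

theorem exists_sup_projection {M : VonNeumannAlgebra H} {I : Type*} (u : I → H →L[ℂ] H)
    (hu : ∀ i, u i ∈ M) :
    ∃ p ∈ M, IsStarProjection p ∧ (∀ i, p * u i = u i) ∧
      ∀ b : H →L[ℂ] H, (∀ i, b * u i = 0) → b * p = 0 := by
  obtain ⟨p, hp, h1, h2, h3⟩ := exists_projection {v : H | ∃ i w, v = u i w}
  refine ⟨p, mem_of_commute fun T hT => h3 T ?_ ?_, hp, fun i => ?_, fun b hb => h2 b ?_⟩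
  · rintro _ ⟨i, w, rfl⟩
    exact ⟨i, T w, by rw [← clm_mul_apply, commute_of_mem (hu i) hT, clm_mul_apply]⟩
  · rintro _ ⟨i, w, rfl⟩
    exact ⟨i, star T w, by
      rw [← clm_mul_apply, commute_of_mem (hu i) (star_mem hT), clm_mul_apply]⟩
  · ext w
    exact h1 _ ⟨i, w, rfl⟩
  · rintro _ ⟨i, w, rfl⟩
    rw [← clm_mul_apply, hb]
    rfl

/-- Orthogonal families of systems can be summed. -/
theorem exists_sum_system {M : VonNeumannAlgebra H} {I : Type*} (u : I → ℕ → H →L[ℂ] H)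
    (hu : ∀ i, IsSystem M (u i))
    (ho : ∀ i i', i ≠ i' → ∀ j k, star (u i j) * u i' k = 0) :
    ∃ U, IsSystem M U ∧ ∀ i k, U k * star (u i k) = u i k * star (u i k) := by
  have ho' : ∀ i i', i ≠ i' → ∀ j k, u i j * star (u i' k) = 0 := by
    intro i i' hi j k
    have h0 : u i 0 * u i' 0 = 0 := by
      rw [← ho i i' hi 0 0, (hu i).proj.isSelfAdjoint.star_eq]
    have h1 : star (u i' k) = u i' 0 * star (u i' k) := by
      have := congrArg star ((hu i').mul_first k)
      rw [star_mul, (hu i').proj.isSelfAdjoint.star_eq] at this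
      exact this.symm
    rw [← (hu i).mul_first j, h1, mul_assoc, ← mul_assoc (u i 0), h0, zero_mul, mul_zero]
  choose U hUM hUP hA hB hC hD using fun k => exists_sum_partialIsometry (M := M)
    (fun i => u i k) (fun i => (hu i).mem k) (fun i => (hu i).partialIsometry k)
    (fun i j hij => ho i j hij k k) (fun i j hij => ho' i j hij k k)
  have hA' : ∀ k i, star (U k) * u i k = u i 0 := by
    intro k i
    have := congrArg star (hA k i)
    simpa only [star_mul, star_star, (hu i).star_mul_self, (hu i).proj.isSelfAdjoint.star_eq]
      using this
  have hB' : ∀ k i, u i k * star (U k) = u i k * star (u i k) := by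
    intro k i
    have := congrArg star (hB k i)
    simpa only [star_mul, star_star] using this
  have h0 : star (U 0) * U 0 = U 0 := by
    have := hD 0 (star (U 0) - 1) fun i => by rw [sub_mul, hA', one_mul, sub_self]
    rwa [sub_mul, one_mul, sub_eq_zero] at this
  have hsa : star (U 0) = U 0 := (isStarProjection_of_star_mul_self h0).isSelfAdjoint.star_eq
  refine ⟨U, ⟨hUM, fun k => ?_, fun j k hjk => ?_⟩, fun i k => hB k i⟩
  · have h1 : U k * U 0 = U k := by
      have := hC k (1 - U 0) fun i => by
        have : u i 0 * U 0 = u i 0 := by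
          have := hA 0 i
          rwa [(hu i).star_mul_self, (hu i).proj.isSelfAdjoint.star_eq] at this
        rw [← (hu i).mul_first k, mul_assoc, mul_sub, this, mul_one, sub_self, mul_zero]
      rw [mul_sub, mul_one, sub_eq_zero] at this
      exact this.symm
    have h2 : U 0 * (star (U k) * U k) = U 0 := by
      have := hC 0 (1 - star (U k) * U k) fun i => by
        rw [mul_sub, mul_one, sub_eq_zero, ← mul_assoc]
        conv_rhs => rw [← (hu i).star_mul_self k, mul_assoc (star (u i k)), hB',
          ← mul_assoc, mul_assoc, hA, (hu i).star_mul_self,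
          (hu i).proj.isIdempotentElem.eq]
      rw [mul_sub, mul_one, sub_eq_zero] at this
      exact this.symm
    have h3 : star (U k) * U k * U 0 = star (U k) * U k := by rw [mul_assoc, h1]
    have h4 := congrArg star h3
    simp only [star_mul, star_star, hsa] at h4
    rw [← h4, h2]
  · have h1 : ∀ i, star (u i k) * U j = 0 := fun i => hD j _ fun i' => by
      by_cases h : i = i'
      · subst h
        exact (hu i).ortho k j hjk.symm
      · exact ho i i' h k j
    refine hD k _ fun i => ?_
    have := congrArg star (h1 i)
    simpa only [star_mul, star_star, star_zero] using this

theorem exists_maximal_system (M : VonNeumannAlgebra H) :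
    ∃ U p, IsTower M U (U 0) p ∧
      ∀ v, IsSystem M v → (∀ k, p * v k = 0) → v 0 = 0 := by
  obtain ⟨S, hS, hSo, hmax⟩ := exists_maximal_pairwise (IsSystem M)
    (fun u v => ∀ j k, star (u j) * v k = 0)
  obtain ⟨U, hU, hUS⟩ := exists_sum_system (I := S) (fun u => u.1) (fun u => hS _ u.2)
    (fun u v huv => hSo u.2 v.2 (fun h => huv (Subtype.ext h)))
  obtain ⟨p, hpM, hp, hpU, hpz⟩ := exists_sup_projection U hU.mem
  refine ⟨U, p, ⟨hU.mem, hU.proj, hU.star_mul_self, hU.ortho, hp, hpM, hpU, hpz⟩,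
    fun v hv hpv => ?_⟩
  have hpu : ∀ u ∈ S, ∀ k, p * u k = u k := by
    intro u hu k
    rw [← (hS u hu).partialIsometry k, ← hUS ⟨u, hu⟩ k, ← mul_assoc, ← mul_assoc, hpU]
  have ho : ∀ u ∈ S, ∀ j k, star (u j) * v k = 0 := by
    intro u hu j k
    rw [← hpu u hu j, star_mul, hp.isSelfAdjoint.star_eq, mul_assoc, hpv, mul_zero]
  have hvS : v ∈ S := hmax v hv fun u hu => ⟨ho u hu, fun j k => by
    have := congrArg star (ho u hu k j)
    simpa only [star_mul, star_star, star_zero] using this⟩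
  rw [← hpu v hvS, hpv]

theorem IsTower.mul_self {M : VonNeumannAlgebra H} {t : ℕ → H →L[ℂ] H} {e p : H →L[ℂ] H}
    (h : IsTower M t e p) (k : ℕ) : t k * e = t k :=
  mul_eq_self_of_star_mul h.proj (h.star_mul_self k)

theorem IsTower.exists_shift {M : VonNeumannAlgebra H} {t : ℕ → H →L[ℂ] H} {e p : H →L[ℂ] H}
    (h : IsTower M t e p) {f : ℕ → ℕ} (hf : Function.Injective f) :
    ∃ V ∈ M, (∀ k, V * t k = t (f k)) ∧ (∀ k, star V * t (f k) = t k) ∧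
      (∀ k, k ∉ Set.range f → star V * t k = 0) ∧ V * p = V ∧ p * V = V := by
  have hstar : ∀ k, e * star (t k) = star (t k) := fun k => by
    have := congrArg star (h.mul_self k)
    rwa [star_mul, h.proj.isSelfAdjoint.star_eq] at this
  have hpt : ∀ k, star (t k) * p = star (t k) := fun k => by
    have := congrArg star (h.mul k)
    rwa [star_mul, h.proj'.isSelfAdjoint.star_eq] at this
  have hs : ∀ k, star (t (f k) * star (t k)) = t k * star (t (f k)) := fun k => by
    rw [star_mul, star_star]
  have hr : ∀ k b, star (t k) * (t k * b) = e * b := fun k b => by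
    rw [← mul_assoc, h.star_mul_self]
  have hr0 : ∀ j k b, j ≠ k → star (t j) * (t k * b) = 0 := fun j k b hjk => by
    rw [← mul_assoc, h.ortho j k hjk, zero_mul]
  obtain ⟨V, hVM, -, hA, hB, hC, hD⟩ := exists_sum_partialIsometry (M := M)
    (fun k => t (f k) * star (t k)) (fun k => mul_mem (h.mem _) (star_mem (h.mem _)))
    (fun k => by rw [hs]; simp only [mul_assoc, hr, hstar])
    (fun j k hjk => by
      rw [hs, mul_assoc, hr0 _ _ _ (fun h => hjk (hf h)), mul_zero])
    (fun j k hjk => by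
      rw [hs, mul_assoc, hr0 _ _ _ hjk, mul_zero])
  refine ⟨V, hVM, fun k => ?_, fun k => ?_, fun k hk => ?_, ?_, ?_⟩
  · have := congrArg (· * t (f k)) (hB k)
    simp only [hs, mul_assoc, hr, hstar, h.star_mul_self, h.mul_self] at this
    exact this
  · have := congrArg star (hA k)
    simp only [star_mul, star_star, mul_assoc, hr, hstar] at this
    have := congrArg (· * t k) this
    simpa only [mul_assoc, h.star_mul_self, h.mul_self] using this
  · have := hD (star (t k)) fun j => hr0 _ _ _ fun h => hk ⟨j, h.symm⟩
    have := congrArg star this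
    simpa only [star_mul, star_star, star_zero] using this
  · have := hC (1 - p) fun k => by rw [mul_assoc, mul_sub, hpt, mul_one, sub_self, mul_zero]
    rw [mul_sub, mul_one, sub_eq_zero] at this
    exact this.symm
  · have := hD (1 - p) fun k => by
      rw [← mul_assoc, sub_mul, h.mul, one_mul, sub_self, zero_mul]
    rw [sub_mul, one_mul, sub_eq_zero] at this
    exact this.symm

theorem star_eq_zero_of_star_mul {u v : H →L[ℂ] H} (h : star u * v = 0) : star v * u = 0 := by
  simpa only [star_mul, star_star, star_zero] using congrArg star h

theorem mul_star_eq_zero {u v : H →L[ℂ] H} (h : u * star v = 0) : v * star u = 0 := by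
  simpa only [star_mul, star_star, star_zero] using congrArg star h

theorem mul_comm_of_eq {p q : H →L[ℂ] H} (hp : IsStarProjection p) (hq : IsStarProjection q)
    (h : p * q = q) : q * p = q := by
  simpa only [star_mul, hp.isSelfAdjoint.star_eq, hq.isSelfAdjoint.star_eq] using congrArg star h

/-- A maximal partial isometry from `p` to `q`. -/
theorem exists_maximal_partialIsometry {M : VonNeumannAlgebra H} {p q : H →L[ℂ] H}
    (hpM : p ∈ M) (hqM : q ∈ M) (hp : IsStarProjection p) (hq : IsStarProjection q) :
    ∃ s ∈ M, s * star s * s = s ∧ s * p = s ∧ q * s = s ∧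
      ∀ m ∈ M, (q - s * star s) * m * (p - star s * s) = 0 := by
  obtain ⟨S, hS, hSo, hmax⟩ := exists_maximal_pairwise
    (fun w : H →L[ℂ] H => w ∈ M ∧ w * star w * w = w ∧ w * p = w ∧ q * w = w)
    (fun w w' => star w * w' = 0 ∧ w * star w' = 0)
  obtain ⟨s, hsM, hs, hA, hB, hC, hD⟩ := exists_sum_partialIsometry (M := M)
    (fun w : S => w.1) (fun w => (hS _ w.2).1) (fun w => (hS _ w.2).2.1)
    (fun w w' h => (hSo w.2 w'.2 fun h' => h (Subtype.ext h')).1)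
    (fun w w' h => (hSo w.2 w'.2 fun h' => h (Subtype.ext h')).2)
  have hsp : s * p = s := by
    have := hC (1 - p) fun w => by rw [mul_sub, mul_one, (hS _ w.2).2.2.1, sub_self]
    rw [mul_sub, mul_one, sub_eq_zero] at this
    exact this.symm
  have hqs : q * s = s := by
    have := hD (1 - q) fun w => by rw [sub_mul, one_mul, (hS _ w.2).2.2.2, sub_self]
    rw [sub_mul, one_mul, sub_eq_zero] at this
    exact this.symm
  refine ⟨s, hsM, hs, hsp, hqs, fun m hm => ?_⟩
  have hps : p * star s = star s := by
    simpa only [star_mul, hp.isSelfAdjoint.star_eq] using congrArg star hsp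
  have hs' : star s * (s * star s) = star s := by
    simpa only [star_mul, star_star, mul_assoc] using congrArg star hs
  obtain ⟨u, huM, hu, hu1, hu2⟩ := exists_polar (M := M)
    (a := (q - s * star s) * m * (p - star s * s))
    (mul_mem (mul_mem (sub_mem hqM (mul_mem hsM (star_mem hsM))) hm)
      (sub_mem hpM (mul_mem (star_mem hsM) hsM)))
  have hup : u * p = u := by
    have : u * (1 - p) = 0 := (hu1 _).2 (by
      rw [mul_assoc, sub_mul p, mul_sub p, mul_assoc (star s), mul_sub s, hsp,
        hp.isIdempotentElem.eq]
      simp)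
    rw [mul_sub, mul_one, sub_eq_zero] at this
    exact this.symm
  have hqu : q * u = u := by
    have : (1 - q) * u = 0 := (hu2 _).2 (by
      rw [← mul_assoc, ← mul_assoc, sub_mul 1, mul_sub q, ← mul_assoc q s, hqs,
        hq.isIdempotentElem.eq]
      simp)
    rw [sub_mul, one_mul, sub_eq_zero] at this
    exact this.symm
  have hsu : star s * u = 0 := (hu2 _).2 (by
    have hsq : star s * q = star s := by
      simpa only [star_mul, hq.isSelfAdjoint.star_eq] using congrArg star hqs
    rw [← mul_assoc, ← mul_assoc, mul_sub (star s), hsq, hs', sub_self, zero_mul, zero_mul])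
  have hus : u * star s = 0 := (hu1 _).2 (by
    rw [mul_assoc, sub_mul p, hps, mul_assoc (star s), hs', sub_self, mul_zero])
  have h1 : ∀ w ∈ S, star w * u = 0 := fun w hw => by
    have h := hB ⟨w, hw⟩
    have h' : w = s * star w * w := by rw [h, (hS w hw).2.1]
    rw [h']
    simp only [star_mul, mul_assoc, hsu, mul_zero]
  have h2 : ∀ w ∈ S, u * star w = 0 := fun w hw => by
    have h := hA ⟨w, hw⟩
    have h' : w = w * star w * s := by rw [mul_assoc, h, ← mul_assoc, (hS w hw).2.1]
    rw [h', star_mul, ← mul_assoc, hus, zero_mul]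
  have huS : u ∈ S := hmax u ⟨huM, hu, hup, hqu⟩ fun w hw =>
    ⟨⟨h1 w hw, mul_star_eq_zero (h2 w hw)⟩, star_eq_zero_of_star_mul (h1 w hw), h2 w hw⟩
  have hu0 : u = 0 := eq_zero_of_star_mul (h1 u huS)
  have := (hu1 1).1 (by rw [hu0, zero_mul])
  rwa [mul_one] at this

theorem exists_central_cover {M : VonNeumannAlgebra H} {p : H →L[ℂ] H} (hpM : p ∈ M) :
    ∃ z ∈ M, z ∈ M.commutant ∧ IsStarProjection z ∧ z * p = p ∧
      ∀ c : H →L[ℂ] H, (∀ a ∈ M, c * a * p = 0) → c * z = 0 := by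
  obtain ⟨z, hzM, hzM', hz, h1, h2⟩ := exists_central_support M (Set.range p) (by
    rintro T hT _ ⟨v, rfl⟩
    exact ⟨T v, by rw [← clm_mul_apply, ← commute_of_mem hpM hT, clm_mul_apply]⟩)
  refine ⟨z, hzM, hzM', hz, ?_, fun c hc => h2 c ?_⟩
  · ext v
    exact h1 _ ⟨v, rfl⟩
  · rintro a ha _ ⟨v, rfl⟩
    rw [← clm_mul_apply, ← clm_mul_apply, hc a ha]
    rfl

theorem exists_comparison {M : VonNeumannAlgebra H} {U : ℕ → H →L[ℂ] H} {p P : H →L[ℂ] H}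
    (hU : IsTower M U (U 0) p) (hmax : ∀ v, IsSystem M v → (∀ k, p * v k = 0) → v 0 = 0)
    (hPM : P ∈ M) (hP : IsStarProjection P) (hPp : P * p = p)
    (hPs : ∀ c : H →L[ℂ] H, (∀ a ∈ M, c * a * p = 0) → c * P = 0) :
    ∃ w ∈ M, w * star w = P - p ∧ w * star w * w = w ∧ w * p = w ∧ p * w = 0 := by
  have hp := hU.proj'
  have hpP : p * P = p := mul_comm_of_eq hP hp hPp
  have hq : IsStarProjection (P - p) := by
    refine ⟨?_, hP.isSelfAdjoint.sub hp.isSelfAdjoint⟩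
    change (P - p) * (P - p) = P - p
    rw [mul_sub, sub_mul, sub_mul, hP.isIdempotentElem.eq, hpP, hPp, hp.isIdempotentElem.eq]
    simp
  obtain ⟨s, hsM, hs, hsp, hqs, hsm⟩ := exists_maximal_partialIsometry hU.mem'
    (sub_mem hPM hU.mem') hp hq
  have hps : p * s = 0 := by
    rw [← hqs, ← mul_assoc, mul_sub, hpP, hp.isIdempotentElem.eq, sub_self, zero_mul]
  refine ⟨s, hsM, ?_, hs, hsp, hps⟩
  have hbM : P - p - s * star s ∈ M := sub_mem (sub_mem hPM hU.mem') (mul_mem hsM (star_mem hsM))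
  obtain ⟨z, hzM, hzM', hz, hzb, hzs⟩ := exists_central_cover hbM
  have hzc : ∀ m ∈ M, m * z = z * m := fun m hm => (commute_of_mem hm hzM').symm
  have hzz : ∀ c : H →L[ℂ] H, z * (z * c) = z * c := fun c => by
    rw [← mul_assoc, hz.isIdempotentElem.eq]
  have haz : p * z = star s * s * z := by
    rw [← sub_eq_zero, ← sub_mul]
    refine hzs _ fun m hm => ?_
    have := congrArg star (hsm (star m) (star_mem hm))
    simpa only [star_mul, star_sub, star_star, star_zero, hp.isSelfAdjoint.star_eq,
      hP.isSelfAdjoint.star_eq, mul_assoc] using this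
  have hsz : ∀ j k, star (s * z * U j) * (s * z * U k) = star (U j) * (z * U k) := by
    intro j k
    have h1 : star (s * z * U j) = star (U j) * (z * star s) := by
      rw [star_mul, star_mul, hz.isSelfAdjoint.star_eq]
    have h3 : star s * (s * (z * U k)) = z * U k := by
      rw [← mul_assoc, ← mul_assoc, ← haz, mul_assoc, ← hzc _ (hU.mem k), ← mul_assoc, hU.mul]
    rw [h1, mul_assoc, mul_assoc, mul_assoc s, h3, hzz]
  have hsz0 : ∀ j k, j ≠ k → star (s * z * U j) * (s * z * U k) = 0 := fun j k hjk => by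
    rw [hsz, ← hzc _ (hU.mem k), ← mul_assoc, hU.ortho j k hjk, zero_mul]
  have hsz1 : ∀ k, star (s * z * U k) * (s * z * U k) = z * U 0 := fun k => by
    rw [hsz, ← hzc _ (hU.mem k), ← mul_assoc, hU.star_mul_self k, hzc _ (hU.mem 0)]
  have hs0 : s * z * U 0 * (z * U 0) = s * z * U 0 := by
    rw [← hzc _ (hU.mem 0), mul_assoc, ← mul_assoc (U 0), hU.mul_self, mul_assoc s,
      hzc _ (hU.mem 0), hzz, mul_assoc]
  have hsys : IsSystem M fun k => s * z * U k * star (s * z * U 0) := by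
    have hm : ∀ k, s * z * U k ∈ M := fun k => mul_mem (mul_mem hsM hzM) (hU.mem k)
    refine ⟨fun k => mul_mem (hm k) (star_mem (hm 0)), fun k => ?_, fun j k hjk => ?_⟩
    · rw [star_mul, star_star, mul_assoc, ← mul_assoc (star (s * z * U k)), hsz1, ← mul_assoc,
        hs0]
    · rw [star_mul, star_star, mul_assoc, ← mul_assoc (star (s * z * U j)), hsz0 j k hjk,
        zero_mul, mul_zero]
  have h0 : s * z * U 0 * star (s * z * U 0) = 0 := hmax _ hsys fun k => by
    simp only [← mul_assoc, hps, zero_mul]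
  have h0' : s * z * U 0 = 0 := by
    rw [← hs0, ← hsz1 0, ← mul_assoc, h0, zero_mul]
  have hzU0 : z * U 0 = 0 := by rw [← hsz1 0, h0', mul_zero]
  have hzp : z * p = 0 := hU.eq_zero z fun k => by
    rw [← hU.mul_self k, ← mul_assoc, ← hzc _ (hU.mem k), mul_assoc, hzU0, mul_zero]
  have hzP : z * P = 0 := hPs z fun m hm => by
    rw [← hzc m hm, mul_assoc, hzp, mul_zero]
  have hPs' : P * s = s := by
    rw [← hqs, ← mul_assoc, mul_sub, hP.isIdempotentElem.eq, hPp]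
  have hPb : P * (P - p - s * star s) = P - p - s * star s := by
    rw [mul_sub, mul_sub, ← mul_assoc, hPs', hPp, hP.isIdempotentElem.eq]
  have : P - p - s * star s = 0 := by
    rw [← hzb, ← hPb, ← mul_assoc, hzP, zero_mul]
  exact (sub_eq_zero.1 this).symm

theorem IsTower.exists_nested {M : VonNeumannAlgebra H} {U : ℕ → H →L[ℂ] H} {e p : H →L[ℂ] H}
    (hU : IsTower M U e p) :
    ∃ X : ℕ → H →L[ℂ] H, (∀ l, X l ∈ M) ∧ (∀ l, star (X l) * X l = p) ∧
      (∀ j k, j ≠ k → star (X j) * X k = 0) ∧ (∀ l, X l * p = X l) ∧ (∀ l, p * X l = X l) ∧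
      ∀ b : H →L[ℂ] H, (∀ l, b * X l = 0) → b * p = 0 := by
  choose X hXM h1 h2 h3 h4 h5 using fun l => hU.exists_shift (f := Nat.pair l)
    fun a b hab => (Nat.pair_eq_pair.1 hab).2
  refine ⟨X, hXM, fun l => ?_, fun j k hjk => ?_, h4, h5, fun b hb => hU.eq_zero b fun k => ?_⟩
  · have := hU.eq_zero (star (X l) * X l - 1) fun k => by
      rw [sub_mul, mul_assoc, h1, h2, one_mul, sub_self]
    rwa [sub_mul, one_mul, mul_assoc, h4, sub_eq_zero] at this
  · have := hU.eq_zero (star (X j) * X k) fun m => by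
      rw [mul_assoc, h1, h3]
      rintro ⟨i, hi⟩
      exact hjk (Nat.pair_eq_pair.1 hi).1
    rwa [mul_assoc, h4] at this
  · rw [← Nat.pair_unpair k, ← h1, ← mul_assoc, hb, zero_mul]

theorem IsTower.exists_absorb {M : VonNeumannAlgebra H} {U : ℕ → H →L[ℂ] H} {e p P w : H →L[ℂ] H}
    (hU : IsTower M U e p) (hPM : P ∈ M) (hP : IsStarProjection P) (hPp : P * p = p)
    (hwM : w ∈ M) (hw : w * star w = P - p) (hw' : w * star w * w = w) (hwp : w * p = w)
    (hpw : p * w = 0) : ∃ t, IsTower M t p P := by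
  obtain ⟨X, hXM, hX1, hX0, hXp, hpX, hX⟩ := hU.exists_nested
  have hp := hU.proj'
  set h := star w * w with hh
  have hwh : w * h = w := by rw [hh, ← mul_assoc, hw']
  have hhp : h * p = h := by rw [hh, mul_assoc, hwp]
  have hhM : h ∈ M := mul_mem (star_mem hwM) hwM
  have hhP : IsStarProjection h := isStarProjection_star_mul hw'
  have hph : p * h = h := by
    simpa only [star_mul, hp.isSelfAdjoint.star_eq, hhP.isSelfAdjoint.star_eq] using
      congrArg star hhp
  have hh2 := hhP.isIdempotentElem.eq
  have hp2 := hp.isIdempotentElem.eq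
  have hPw : P * w = w := by
    rw [← hw', hw, ← mul_assoc, mul_sub, hP.isIdempotentElem.eq, hPp]
  have hXw : ∀ l, star (X l) * w = 0 := fun l => by
    have : star (X l) * p = star (X l) := by
      simpa only [star_mul, hp.isSelfAdjoint.star_eq] using congrArg star (hpX l)
    rw [← this, mul_assoc, hpw, mul_zero]
  let Y : ℕ → H →L[ℂ] H := fun l => Nat.casesOn l w fun l => X l * h
  have hYM : ∀ l, Y l ∈ M := fun l => by
    cases l with
    | zero => exact hwM
    | succ l => exact mul_mem (hXM l) hhM
  have hPY : ∀ l, P * Y l = Y l := fun l => by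
    cases l with
    | zero => exact hPw
    | succ l =>
      change P * (X l * h) = X l * h
      rw [← hpX l, mul_assoc, ← mul_assoc, hPp]
  have hYh : ∀ l, Y l * (p - h) = 0 := fun l => by
    cases l with
    | zero =>
      change w * (p - h) = 0
      rw [mul_sub, hwp, hwh, sub_self]
    | succ l =>
      change X l * h * (p - h) = 0
      rw [mul_assoc, mul_sub, hhp, hh2, sub_self, mul_zero]
  have hYY1 : ∀ l, star (Y l) * Y l = h := fun l => by
    cases l with
    | zero => rfl
    | succ l =>
      change star (X l * h) * (X l * h) = h
      rw [star_mul, mul_assoc, ← mul_assoc (star (X l)), hX1, hph, hhP.isSelfAdjoint.star_eq, hh2]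
  have hYY0 : ∀ j k, j ≠ k → star (Y j) * Y k = 0 := fun j k hjk => by
    cases j with
    | zero =>
      cases k with
      | zero => exact absurd rfl hjk
      | succ k =>
        change star w * (X k * h) = 0
        rw [← mul_assoc, star_eq_zero_of_star_mul (hXw k), zero_mul]
    | succ j =>
      cases k with
      | zero =>
        change star (X j * h) * w = 0
        rw [star_mul, mul_assoc, hXw, mul_zero]
      | succ k =>
        change star (X j * h) * (X k * h) = 0
        rw [star_mul, mul_assoc, ← mul_assoc (star (X j)), hX0 j k fun h => hjk (by rw [h]),
          zero_mul, mul_zero]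
  have hXY : ∀ j k, star (X j * (p - h)) * Y k = 0 := fun j k => by
    have hs : star (X j * (p - h)) = (p - h) * star (X j) := by
      rw [star_mul, star_sub, hp.isSelfAdjoint.star_eq, hhP.isSelfAdjoint.star_eq]
    cases k with
    | zero =>
      change _ * w = 0
      rw [hs, mul_assoc, hXw, mul_zero]
    | succ k =>
      change _ * (X k * h) = 0
      rw [hs, mul_assoc, ← mul_assoc (star (X j))]
      by_cases hjk : j = k
      · rw [hjk, hX1, hph, sub_mul, hph, hh2, sub_self]
      · rw [hX0 j k hjk, zero_mul, mul_zero]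
  have hd : (p - h) * (p - h) = p - h := by
    rw [mul_sub, sub_mul, sub_mul, hp2, hhp, hph, hh2, sub_self, sub_zero]
  have hds : star (p - h) = p - h := by
    rw [star_sub, hp.isSelfAdjoint.star_eq, hhP.isSelfAdjoint.star_eq]
  have hprod : ∀ j k, star (X j * (p - h) + Y j) * (X k * (p - h) + Y k) =
      (p - h) * (star (X j) * X k) * (p - h) + star (Y j) * Y k := fun j k => by
    rw [star_add, add_mul, mul_add, mul_add, hXY, star_eq_zero_of_star_mul (hXY k j), star_mul,
      hds]
    simp only [mul_assoc, add_zero, zero_add]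
  refine ⟨fun l => X l * (p - h) + Y l, ⟨fun k => add_mem (mul_mem (hXM k)
    (sub_mem hU.mem' hhM)) (hYM k), hp, fun k => ?_, fun j k hjk => ?_, hP, hPM, fun k => ?_,
    fun b hb => ?_⟩⟩
  · rw [hprod, hX1, hYY1, mul_assoc, mul_sub p, hp2, hph, hd, sub_add_cancel]
  · rw [hprod, hX0 j k hjk, hYY0 j k hjk, mul_zero, zero_mul, add_zero]
  · rw [mul_add, hPY, ← mul_assoc, ← hpX k, ← mul_assoc, hPp]
  · have h1 : ∀ l, b * (X l * (p - h)) = 0 := fun l => by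
      have := congrArg (· * (p - h)) (hb l)
      simpa only [mul_assoc, add_mul, mul_add, hd, hYh, mul_zero, add_zero, zero_mul] using this
    have h2 : ∀ l, b * Y l = 0 := fun l => by
      have := hb l
      rwa [mul_add, h1, zero_add] at this
    have h3 : b * p = 0 := hX b fun l => by
      have := h2 (l + 1)
      change b * (X l * h) = 0 at this
      rw [← hXp l, ← sub_add_cancel p h, mul_add, mul_add, h1, this, zero_add]
    have h4 : b * (P - p) = 0 := by
      have : b * w = 0 := h2 0
      rw [← hw, ← mul_assoc, this, zero_mul]
    rwa [mul_sub, h3, sub_zero] at h4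

/-- The properly infinite part of `M`: a central projection carrying a tower, whose complement
contains no system. -/
theorem exists_tower (M : VonNeumannAlgebra H) :
    ∃ t p P, IsTower M t p P ∧ P ∈ M.commutant ∧
      ∀ v, IsSystem M v → (∀ k, P * v k = 0) → v 0 = 0 := by
  obtain ⟨U, p, hU, hmax⟩ := exists_maximal_system M
  obtain ⟨P, hPM, hPM', hP, hPp, hPs⟩ := exists_central_cover hU.mem'
  obtain ⟨w, hwM, hw, hw', hwp, hpw⟩ := exists_comparison hU hmax hPM hP hPp hPs
  obtain ⟨t, ht⟩ := hU.exists_absorb hPM hP hPp hwM hw hw' hwp hpw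
  refine ⟨t, p, P, ht, hPM', fun v hv hPv => hmax v hv fun k => ?_⟩
  rw [← mul_comm_of_eq hP hU.proj' hPp, mul_assoc, hPv, mul_zero]

theorem mem_closure_span_of_total {q : H →L[ℂ] H} {X : Set H}
    (hq : ∀ c : H →L[ℂ] H, (∀ v ∈ X, c v = 0) → c * q = 0) (v : H) :
    q v ∈ (Submodule.span ℂ X).topologicalClosure := by
  obtain ⟨r, hr⟩ : ∃ r : H →L[ℂ] H,
      r = (Submodule.span ℂ X).topologicalClosure.starProjection := ⟨_, rfl⟩
  have h := hq (1 - r) fun w hw => by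
    have : w ∈ (Submodule.span ℂ X).topologicalClosure :=
      Submodule.le_topologicalClosure _ (Submodule.subset_span hw)
    rw [sub_apply, hr, Submodule.starProjection_eq_self_iff.2 this, one_apply_eq_self, sub_self]
  have h' : q v = r (q v) := by
    have := congrArg (fun c : H →L[ℂ] H => c v) h
    rw [clm_mul_apply, sub_apply, one_apply_eq_self] at this
    exact sub_eq_zero.1 this
  rw [h', hr]
  exact Submodule.starProjection_apply_mem _ _

theorem tendsto_of_total {ι : Type*} {l : Filter ι} {T : ι → H →L[ℂ] H} {T₀ q : H →L[ℂ] H}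
    {B : ℝ} (hT : ∀ i, ‖T i‖ ≤ B) {X : Set H}
    (hq : ∀ c : H →L[ℂ] H, (∀ v ∈ X, c v = 0) → c * q = 0)
    (hX : ∀ v ∈ X, Tendsto (fun i => T i v) l (nhds (T₀ v))) (v : H) :
    Tendsto (fun i => T i (q v)) l (nhds (T₀ (q v))) := by
  have hspan : ∀ w ∈ Submodule.span ℂ X, Tendsto (fun i => T i w) l (nhds (T₀ w)) := by
    intro w hw
    induction hw using Submodule.span_induction with
    | mem w hw => exact hX w hw
    | zero => simpa only [map_zero] using tendsto_const_nhds
    | add a b _ _ ha hb => simpa only [map_add] using ha.add hb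
    | smul c a _ ha => simpa only [map_smul] using ha.const_smul c
  have hqv := mem_closure_span_of_total hq v
  rw [Metric.tendsto_nhds]
  intro ε hε
  have hB : 0 < |B| + ‖T₀‖ + 1 := by positivity
  obtain ⟨u, hu, huv⟩ := Metric.mem_closure_iff.1 hqv (ε / (2 * (|B| + ‖T₀‖ + 1))) (by positivity)
  filter_upwards [Metric.tendsto_nhds.1 (hspan u hu) (ε / 2) (by positivity)] with i hi
  rw [dist_eq_norm] at *
  have h1 : T i (q v) - T₀ (q v) = T i (q v - u) + (T i u - T₀ u) - T₀ (q v - u) := by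
    simp only [map_sub]
    abel
  have h2 : ‖T i (q v - u)‖ ≤ |B| * ‖q v - u‖ :=
    ((T i).le_opNorm _).trans (mul_le_mul_of_nonneg_right ((hT i).trans (le_abs_self B))
      (norm_nonneg _))
  have h3 : ‖T₀ (q v - u)‖ ≤ ‖T₀‖ * ‖q v - u‖ := T₀.le_opNorm _
  have h4 : (|B| + ‖T₀‖ + 1) * ‖q v - u‖ < ε / 2 := by
    have := mul_lt_mul_of_pos_left huv hB
    refine this.trans_eq ?_
    field_simp
  calc ‖T i (q v) - T₀ (q v)‖ ≤ ‖T i (q v - u)‖ + ‖T i u - T₀ u‖ + ‖T₀ (q v - u)‖ := by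
        rw [h1]
        exact (norm_sub_le _ _).trans (add_le_add_left (norm_add_le _ _) _)
    _ < ε := by nlinarith [norm_nonneg (q v - u)]

/-- A central projection on which `x` is a strong-* limit of a bounded sequence of
`n`-divisible elements. -/
def Good (M : VonNeumannAlgebra H) (n : ℕ) (x : H →L[ℂ] H) (B : ℝ) (c : H →L[ℂ] H) : Prop :=
  c ∈ M ∧ c ∈ M.commutant ∧ IsStarProjection c ∧
  ∃ (a : ℕ → H →L[ℂ] H) (φ : ℕ → Matrix (Fin n) (Fin n) ℂ →⋆ₙₐ[ℂ] (H →L[ℂ] H)),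
    (∀ k, a k ∈ M) ∧ (∀ k, ‖a k‖ ≤ B) ∧ (∀ k T, φ k T ∈ M) ∧ (∀ k, φ k 1 * c = c) ∧
    (∀ k T, φ k T * a k * c = a k * φ k T * c) ∧
    (∀ v, Tendsto (fun k => a k (c v)) atTop (nhds (x (c v)))) ∧
    ∀ v, Tendsto (fun k => star (a k) (c v)) atTop (nhds (star x (c v)))

theorem Good.mono {M : VonNeumannAlgebra H} {n : ℕ} {x c d : H →L[ℂ] H} {B : ℝ}
    (h : Good M n x B c) (hdM : d ∈ M) (hdM' : d ∈ M.commutant) (hd : IsStarProjection d)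
    (hcd : c * d = d) : Good M n x B d := by
  obtain ⟨-, -, -, a, φ, h1, h2, h3, h4, h5, h6, h7⟩ := h
  refine ⟨hdM, hdM', hd, a, φ, h1, h2, h3, fun k => ?_, fun k T => ?_, fun v => ?_, fun v => ?_⟩
  · rw [← hcd, ← mul_assoc, h4]
  · rw [← hcd, ← mul_assoc, h5, mul_assoc]
  · simpa only [← clm_mul_apply, hcd] using h6 (d v)
  · simpa only [← clm_mul_apply c, hcd] using h7 (d v)

section MatrixHom

variable {n : ℕ} (V : Fin n → H →L[ℂ] H) (P : H →L[ℂ] H)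

/-- The `*`-homomorphism given by the matrix units `V r * star (V s)`. -/
noncomputable def matrixHom (h : ∀ r s, star (V r) * V s = if r = s then P else 0)
    (hV : ∀ r, V r * P = V r) :
    Matrix (Fin n) (Fin n) ℂ →⋆ₙₐ[ℂ] (H →L[ℂ] H) where
  toFun T := ∑ r, ∑ s, T r s • (V r * star (V s))
  map_smul' c T := by
    simp only [Matrix.smul_apply, smul_eq_mul, mul_smul, Finset.smul_sum, MonoidHom.id_apply]
  map_zero' := by simp
  map_add' T T' := by simp only [Matrix.add_apply, add_smul, Finset.sum_add_distrib]
  map_mul' T T' := by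
    have key : ∀ r s r' s', V r * star (V s) * (V r' * star (V s')) =
        if s = r' then V r * star (V s') else 0 := fun r s r' s' => by
      rw [mul_assoc, ← mul_assoc (star (V s)), h]
      split_ifs
      · rw [← mul_assoc, hV]
      · rw [zero_mul, mul_zero]
    rw [Finset.sum_mul]
    refine Finset.sum_congr rfl fun r _ => ?_
    rw [Finset.sum_mul]
    simp only [Matrix.mul_apply, Finset.sum_smul]
    rw [Finset.sum_comm]
    refine Finset.sum_congr rfl fun s _ => ?_
    simp only [Finset.mul_sum, smul_mul_assoc, mul_smul_comm, key, smul_ite, smul_zero]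
    rw [Finset.sum_comm]
    simp only [Finset.sum_ite_eq, Finset.mem_univ, if_true, smul_smul, mul_comm]
  map_star' T := by
    simp only [star_sum, star_smul, star_mul, star_star, Matrix.star_apply]
    exact Finset.sum_comm

theorem matrixHom_apply (h : ∀ r s, star (V r) * V s = if r = s then P else 0)
    (hV : ∀ r, V r * P = V r) (T : Matrix (Fin n) (Fin n) ℂ) :
    matrixHom V P h hV T = ∑ r, ∑ s, T r s • (V r * star (V s)) := rfl

end MatrixHom

/-- Inflation of `x` along isometries with orthogonal ranges. -/
noncomputable def inflate {n : ℕ} (V : Fin n → H →L[ℂ] H) (x : H →L[ℂ] H) : H →L[ℂ] H :=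
  ∑ r, V r * x * star (V r)

theorem star_inflate {n : ℕ} (V : Fin n → H →L[ℂ] H) (x : H →L[ℂ] H) :
    star (inflate V x) = inflate V (star x) := by
  simp only [inflate, star_sum, star_mul, star_star, mul_assoc]

theorem norm_inflate_le {n : ℕ} {V : Fin n → H →L[ℂ] H} (hV : ∀ r, ‖V r‖ ≤ 1) (x : H →L[ℂ] H) :
    ‖inflate V x‖ ≤ n * ‖x‖ := by
  have : ∀ r ∈ Finset.univ, ‖V r * x * star (V r)‖ ≤ ‖x‖ := fun r _ => by
    calc ‖V r * x * star (V r)‖ ≤ ‖V r‖ * ‖x‖ * ‖star (V r)‖ :=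
          (norm_mul_le _ _).trans (mul_le_mul_of_nonneg_right (norm_mul_le _ _) (norm_nonneg _))
      _ ≤ 1 * ‖x‖ * 1 := by
          rw [norm_star]
          gcongr <;> exact hV r
      _ = ‖x‖ := by ring
  simpa [inflate] using norm_sum_le_of_le _ this

theorem matrixHom_mul_inflate {n : ℕ} {V : Fin n → H →L[ℂ] H} {P x : H →L[ℂ] H}
    (h : ∀ r s, star (V r) * V s = if r = s then P else 0) (hV : ∀ r, V r * P = V r)
    (hx : P * x = x * P) (hP : IsStarProjection P) (T : Matrix (Fin n) (Fin n) ℂ) :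
    matrixHom V P h hV T * inflate V x = inflate V x * matrixHom V P h hV T := by
  have hV' : ∀ r, P * star (V r) = star (V r) := fun r => by
    simpa only [star_mul, hP.isSelfAdjoint.star_eq] using congrArg star (hV r)
  have k1 : ∀ r s q, V r * star (V s) * (V q * x * star (V q)) =
      if s = q then V r * x * star (V s) else 0 := fun r s q => by
    rw [mul_assoc, mul_assoc, ← mul_assoc (star (V s)), h]
    split_ifs with hsq
    · rw [← mul_assoc P, hx, mul_assoc, hV', ← mul_assoc, hsq]
    · rw [zero_mul, mul_zero]
  have k2 : ∀ r s q, V q * x * star (V q) * (V r * star (V s)) =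
      if q = r then V r * x * star (V s) else 0 := fun r s q => by
    rw [mul_assoc, ← mul_assoc (star (V q)), h]
    split_ifs with hsq
    · rw [hV', hsq]
    · rw [zero_mul, mul_zero]
  simp only [matrixHom_apply, inflate, Finset.sum_mul, Finset.mul_sum, smul_mul_assoc,
    mul_smul_comm, k1, k2, smul_ite, smul_zero, Finset.sum_ite_eq',
    Finset.mem_univ, if_true]
  exact Finset.sum_comm

/-- The pieces of a partition of `ℕ` into `n` infinite sets, the zeroth of which contains
`{0, …, m - 1}`. -/
def branch (n m r l : ℕ) : ℕ :=
  if r = 0 then (if l < m then l else m + n * (l - m)) else m + n * l + r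

theorem branch_eq_iff {n m : ℕ} {r s l k : ℕ} (hr : r < n) (hs : s < n) :
    branch n m r l = branch n m s k ↔ r = s ∧ l = k := by
  refine ⟨fun h => ?_, fun ⟨h1, h2⟩ => by rw [h1, h2]⟩
  have key : ∀ a b r s : ℕ, r < n → s < n → n * a + r = n * b + s → r = s ∧ a = b := by
    intro a b r s hr hs hab
    have h1 := congrArg (· % n) hab
    simp only [Nat.mul_add_mod, Nat.mod_eq_of_lt hr, Nat.mod_eq_of_lt hs] at h1
    subst h1
    exact ⟨rfl, Nat.eq_of_mul_eq_mul_left (by omega : 0 < n) (by omega)⟩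
  unfold branch at h
  split_ifs at h with h1 h2 h3 h4 h5 h6 h7 h8
  · omega
  · omega
  · omega
  · omega
  · have := key (l - m) (k - m) 0 0 (by omega) (by omega) (by omega)
    omega
  · have := key (l - m) k 0 s (by omega) (by omega) (by omega)
    omega
  · omega
  · have := key l (k - m) r 0 (by omega) (by omega) (by omega)
    omega
  · exact key l k r s hr hs (by omega)

theorem exists_branch {n : ℕ} (hn : 0 < n) (m j : ℕ) : ∃ r < n, ∃ l, branch n m r l = j := by
  by_cases hj : j < m
  · exact ⟨0, hn, j, by simp [branch, hj]⟩
  · have h1 := Nat.div_add_mod (j - m) n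
    have h2 := Nat.mod_lt (j - m) hn
    by_cases h0 : (j - m) % n = 0
    · refine ⟨0, hn, m + (j - m) / n, ?_⟩
      simp only [branch, if_true]
      rw [if_neg (Nat.not_lt.2 (Nat.le_add_right _ _)), Nat.add_sub_cancel_left]
      omega
    · refine ⟨(j - m) % n, h2, (j - m) / n, ?_⟩
      simp only [branch, if_neg h0]
      omega

theorem IsTower.exists_branches {M : VonNeumannAlgebra H} {t : ℕ → H →L[ℂ] H} {e P : H →L[ℂ] H}
    (ht : IsTower M t e P) {n : ℕ} (hn : 0 < n) (m : ℕ) :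
    ∃ V : Fin n → H →L[ℂ] H, (∀ r, V r ∈ M) ∧
      (∀ r s, star (V r) * V s = if r = s then P else 0) ∧ (∀ r, V r * P = V r) ∧
      (∀ r, P * V r = V r) ∧
      (∑ r, V r * star (V r) = P) ∧
      (∀ l < m, V ⟨0, hn⟩ * t l = t l) ∧
      (∀ l < m, star (V ⟨0, hn⟩) * t l = t l) ∧
      ∀ r, r ≠ ⟨0, hn⟩ → ∀ l < m, star (V r) * t l = 0 := by
  choose V hVM h1 h2 h3 h4 h5 using fun r : Fin n => ht.exists_shift (f := branch n m r)
    fun a b hab => ((branch_eq_iff r.2 r.2).1 hab).2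
  have hV0 : ∀ r s, r ≠ s → ∀ l, star (V r) * t (branch n m s l) = 0 := fun r s hrs l =>
    h3 r _ fun ⟨k, hk⟩ => hrs (Fin.ext ((branch_eq_iff r.2 s.2).1 hk).1)
  have hb0 : ∀ l < m, branch n m 0 l = l := fun l hl => by simp [branch, hl]
  have h5' : ∀ r, star (V r) * P = star (V r) := fun r => by
    simpa only [star_mul, ht.proj'.isSelfAdjoint.star_eq] using congrArg star (h5 r)
  refine ⟨V, hVM, fun r s => ?_, h4, h5, ?_, fun l hl => ?_, fun l hl => ?_,
    fun r hr l hl => ?_⟩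
  · split_ifs with hrs
    · subst hrs
      have := ht.eq_zero (star (V r) * V r - 1) fun k => by
        rw [sub_mul, mul_assoc, h1, h2, one_mul, sub_self]
      rwa [sub_mul, one_mul, mul_assoc, h4, sub_eq_zero] at this
    · have := ht.eq_zero (star (V r) * V s) fun k => by rw [mul_assoc, h1, hV0 r s hrs]
      rwa [mul_assoc, h4] at this
  · have := ht.eq_zero (∑ r, V r * star (V r) - 1) fun j => by
      obtain ⟨r, hr, l, rfl⟩ := exists_branch hn m j
      rw [sub_mul, Finset.sum_mul, Finset.sum_eq_single ⟨r, hr⟩, mul_assoc, h2 ⟨r, hr⟩, h1,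
        one_mul, sub_self]
      · intro s _ hs
        rw [mul_assoc, hV0 s ⟨r, hr⟩ hs, mul_zero]
      · simp
    simpa only [sub_mul, Finset.sum_mul, mul_assoc, h5', one_mul, sub_eq_zero] using this
  · have := h1 ⟨0, hn⟩ l
    simp only [hb0 l hl] at this
    exact this
  · have := h2 ⟨0, hn⟩ l
    simp only [hb0 l hl] at this
    exact this
  · have := hV0 r ⟨0, hn⟩ hr l
    simp only [hb0 l hl] at this
    exact this

theorem good_of_tower {M : VonNeumannAlgebra H} {t : ℕ → H →L[ℂ] H} {e P x : H →L[ℂ] H}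
    (ht : IsTower M t e P) (hP : P ∈ M.commutant) {n : ℕ} (hn : 0 < n) (hx : x ∈ M) {B : ℝ}
    (hB : n * ‖x‖ ≤ B) : Good M n x B P := by
  choose V hVM hV hVP hPV hVs hV0 hV0' hVr using ht.exists_branches hn
  have hV1 : ∀ m r, ‖V m r‖ ≤ 1 := fun m r => norm_le_one_of_partialIsometry (by
    rw [mul_assoc, hV, if_pos rfl, hVP])
  have htot : ∀ c : H →L[ℂ] H, (∀ v ∈ {v | ∃ k w, v = t k w}, c v = 0) → c * P = 0 := fun c hc =>
    ht.eq_zero c fun k => by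
      ext w
      exact hc _ ⟨k, w, rfl⟩
  have hVlim : ∀ v, Tendsto (fun m => V m ⟨0, hn⟩ (P v)) atTop (nhds (P v)) := fun v => by
    refine tendsto_of_total (T₀ := 1) (fun m => hV1 m _) htot ?_ v
    rintro _ ⟨k, w, rfl⟩
    refine tendsto_const_nhds.congr' ?_
    filter_upwards [eventually_gt_atTop k] with m hm
    rw [one_apply_eq_self, ← clm_mul_apply, hV0 m k hm]
  have hlim : ∀ y ∈ M, ∀ v, Tendsto (fun m => inflate (V m) y (P v)) atTop (nhds (y (P v))) := by
    intro y hy v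
    refine tendsto_of_total (B := n * ‖y‖) (fun m => norm_inflate_le (hV1 m) y) htot ?_ v
    rintro _ ⟨k, w, rfl⟩
    have hyt : y (t k w) = P (y (t k w)) := by
      rw [← clm_mul_apply P, commute_of_mem hy hP, clm_mul_apply y, ← clm_mul_apply P, ht.mul]
    have := hVlim (y (t k w))
    rw [← hyt] at this
    refine this.congr' ?_
    filter_upwards [eventually_gt_atTop k] with m hm
    have h1 : inflate (V m) y * t k = V m ⟨0, hn⟩ * y * t k := by
      rw [inflate, Finset.sum_mul, Finset.sum_eq_single ⟨0, hn⟩]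
      · rw [mul_assoc, hV0' m k hm]
      · intro r _ hr
        rw [mul_assoc, hVr m r hr k hm, mul_zero]
      · simp
    have h2 := congrArg (fun c : H →L[ℂ] H => c w) h1
    simp only [clm_mul_apply] at h2
    exact h2.symm
  have hxP : P * x = x * P := commute_of_mem hx hP
  refine ⟨ht.mem', hP, ht.proj', fun m => inflate (V m) x,
    fun m => matrixHom (V m) P (hV m) (hVP m), fun m => ?_, fun m => ?_, fun m T => ?_, fun m => ?_,
    fun m T => ?_, hlim x hx, fun v => ?_⟩
  · exact sum_mem fun r _ => mul_mem (mul_mem (hVM m r) hx) (star_mem (hVM m r))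
  · exact (norm_inflate_le (hV1 m) x).trans hB
  · rw [matrixHom_apply]
    exact sum_mem fun r _ => sum_mem fun s _ =>
      smul_mem _ (mul_mem (hVM m r) (star_mem (hVM m s)))
  · have : matrixHom (V m) P (hV m) (hVP m) 1 = P := by
      rw [matrixHom_apply, ← hVs m]
      refine Finset.sum_congr rfl fun r _ => ?_
      simp [Matrix.one_apply]
    rw [this, ht.proj'.isIdempotentElem.eq]
  · rw [matrixHom_mul_inflate (hV m) (hVP m) hxP ht.proj']
  · simpa only [star_inflate] using hlim (star x) (star_mem hx) v

theorem isSystem_of_ortho {M : VonNeumannAlgebra H} {u : ℕ → H →L[ℂ] H} {g : H →L[ℂ] H}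
    (hM : ∀ k, u k ∈ M) (h1 : ∀ k, star (u k) * u k = g) (hg : u 0 * g = u 0)
    (h0 : ∀ j k, j ≠ k → star (u j) * u k = 0) : IsSystem M fun k => u k * star (u 0) := by
  refine ⟨fun k => mul_mem (hM k) (star_mem (hM 0)), fun k => ?_, fun j k hjk => ?_⟩
  · rw [star_mul, star_star, mul_assoc, ← mul_assoc (star (u k)), h1, ← mul_assoc, hg]
  · rw [star_mul, star_star, mul_assoc, ← mul_assoc (star (u j)), h0 j k hjk, zero_mul, mul_zero]

/-- A countable family of partial isometries with orthogonal ranges is dominated by a single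
operator with the same joint kernel. -/
theorem exists_sum_countable {M : VonNeumannAlgebra H} {T : Set (H →L[ℂ] H)} (hT : T.Countable)
    (hM : ∀ w ∈ T, w ∈ M) (hw : ∀ w ∈ T, w * star w * w = w)
    (ho : ∀ w ∈ T, ∀ w' ∈ T, w ≠ w' → star w * w' = 0) :
    ∃ A ∈ M, (∀ b, A * b = 0 → ∀ w ∈ T, w * b = 0) ∧
      ∀ b : H →L[ℂ] H, (∀ w ∈ T, b * w = 0) → b * A = 0 := by
  have := hT.toEncodable
  let f : T → H →L[ℂ] H := fun w => ((1 / 2 : ℝ) ^ Encodable.encode w : ℂ) • w.1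
  have hf : Summable f := by
    refine Summable.of_norm_bounded (summable_geometric_two_encode (ι := T)) fun w => ?_
    have h1 : ‖w.1‖ ≤ 1 := norm_le_one_of_partialIsometry (hw w w.2)
    have h2 : ‖((1 / 2 : ℝ) ^ Encodable.encode w : ℂ)‖ = (1 / 2) ^ Encodable.encode w := by
      rw [norm_pow]
      norm_num
    calc ‖f w‖ = (1 / 2) ^ Encodable.encode w * ‖w.1‖ := by rw [← h2]; exact norm_smul _ _
      _ ≤ (1 / 2) ^ Encodable.encode w * 1 := by gcongr
      _ = _ := mul_one _
  obtain ⟨A, hA⟩ := hf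
  have hbA : ∀ b : H →L[ℂ] H, (∀ w ∈ T, b * w = 0) → b * A = 0 := fun b hb => by
    refine (hA.mul_left b).unique ?_
    convert hasSum_zero with w
    change b * (_ • w.1) = 0
    rw [mul_smul_comm, hb w w.2, smul_zero]
  refine ⟨A, hasSum_mem (a := f) (fun w => smul_mem _ (hM w w.2)) fun v => ?_, fun b hb w hwT => ?_,
    hbA⟩
  · have := (ContinuousLinearMap.apply ℂ H v).hasSum hA
    simpa only [ContinuousLinearMap.apply_apply] using this
  · have h1 : star w * A = ((1 / 2 : ℝ) ^ Encodable.encode (⟨w, hwT⟩ : T) : ℂ) • (star w * w) := by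
      refine (hA.mul_left (star w)).unique ?_
      have := hasSum_single (f := fun i => star w * f i) (⟨w, hwT⟩ : T) fun w' hw' => by
        change star w * (_ • w'.1) = 0
        rw [mul_smul_comm, ho w hwT w' w'.2 (fun h => hw' (Subtype.ext h.symm)), smul_zero]
      rw [← mul_smul_comm]
      exact this
    have h2 := congrArg (· * b) h1
    simp only [mul_assoc, hb, mul_zero, smul_mul_assoc] at h2
    have h3 : star w * (w * b) = 0 := by
      refine (smul_eq_zero.1 h2.symm).resolve_left (pow_ne_zero _ ?_)
      norm_num
    rw [← hw w hwT, mul_assoc, mul_assoc, h3, mul_zero]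

theorem exists_countable_subset {M : VonNeumannAlgebra H} {q : H →L[ℂ] H} {ξ : H}
    (hξ : ∀ c : H →L[ℂ] H, (∀ T ∈ M.commutant, c (T ξ) = 0) → c * q = 0)
    (S : Set (H →L[ℂ] H)) (hM : ∀ w ∈ S, w ∈ M) (hq : IsStarProjection q)
    (hSq : ∀ w ∈ S, w * q = w) :
    ∃ T ⊆ S, T.Countable ∧ ∀ h : H →L[ℂ] H, (∀ w ∈ T, w * h = 0) → ∀ w ∈ S, w * h = 0 := by
  let X : Set H := {v | ∃ w ∈ S, ∃ y, v = star w y}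
  obtain ⟨p, hpM, hp, hpS, hpX⟩ := exists_sup_projection (M := M) (fun w : S => star w.1)
    fun w => star_mem (hM w w.2)
  have htot : ∀ c : H →L[ℂ] H, (∀ v ∈ X, c v = 0) → c * p = 0 := fun c hc =>
    hpX c fun w => by
      ext y
      exact hc _ ⟨w, w.2, y, rfl⟩
  obtain ⟨y, hy, hylim⟩ := mem_closure_iff_seq_limit.1 (mem_closure_span_of_total htot ξ)
  choose F hFX hF using fun k => Submodule.mem_span_finite_of_mem_span (hy k)
  have hFc : (⋃ k, (F k : Set H)).Countable := Set.countable_iUnion fun k => (F k).countable_toSet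
  have hFw : ∀ v : (⋃ k, (F k : Set H)), ∃ w ∈ S, ∃ z, v.1 = star w z := fun v => by
    obtain ⟨k, hk⟩ := Set.mem_iUnion.1 v.2
    exact hFX k hk
  choose W hWS Z hWZ using hFw
  have := hFc.to_subtype
  refine ⟨Set.range W, by rintro _ ⟨v, rfl⟩; exact hWS v, Set.countable_range W,
    fun h hh w hw => ?_⟩
  have h1 : ∀ v ∈ Set.range W, star h * star v = 0 := fun v hv => by
    rw [← star_mul, hh v hv, star_zero]
  have h2 : ∀ T ∈ M.commutant, (star h * T) (p ξ) = 0 := fun T hT => by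
    have h3 : ∀ k, (star h * T) (y k) = 0 := fun k => by
      have h4 := hF k
      have h5 : Submodule.span ℂ (F k : Set H) ≤ ((star h * T : H →L[ℂ] H) : H →ₗ[ℂ] H).ker := by
        rw [Submodule.span_le]
        intro v hv
        have hv' : v ∈ ⋃ k, (F k : Set H) := Set.mem_iUnion.2 ⟨k, hv⟩
        have h6 := hWZ ⟨v, hv'⟩
        change (star h * T) v = 0
        change v = _ at h6
        rw [h6, ← clm_mul_apply, mul_assoc, commute_of_mem (star_mem (hM _ (hWS ⟨v, hv'⟩))) hT,
          ← mul_assoc, h1 _ ⟨_, rfl⟩, zero_mul, zero_apply]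
      exact h5 h4
    refine tendsto_nhds_unique (((star h * T).continuous.tendsto _).comp hylim) ?_
    refine tendsto_const_nhds.congr fun k => ?_
    exact (h3 k).symm
  have h3 : star h * p * q = 0 := hξ _ fun T hT => by
    rw [← clm_mul_apply, mul_assoc, ← commute_of_mem hpM hT, ← mul_assoc, clm_mul_apply, h2 T hT]
  have hpq : p * q = p := by
    have : q * p = p := by
      have := hpX (q - 1) fun w => by
        have := congrArg star (hSq w w.2)
        rw [star_mul, hq.isSelfAdjoint.star_eq] at this
        rw [sub_mul, this, one_mul, sub_self]
      rwa [sub_mul, one_mul, sub_eq_zero] at this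
    exact mul_comm_of_eq hq hp this
  rw [mul_assoc, hpq] at h3
  have h4 : star h * star w = 0 := by
    have h4 := hpS ⟨w, hw⟩
    change p * star w = star w at h4
    rw [← h4, ← mul_assoc, h3, zero_mul]
  rw [← star_mul] at h4
  exact star_eq_zero.1 h4

/-- In the absence of systems, orthogonal families of partial isometries supported under a cyclic
projection of the commutant are countable. -/
theorem countable_of_no_system {M : VonNeumannAlgebra H} {R q : H →L[ℂ] H} {ξ : H}
    (hR' : R ∈ M.commutant) (hno : ∀ v, IsSystem M v → (∀ k, R * v k = v k) → v 0 = 0)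
    (hq : IsStarProjection q) (hRq : q * R = q)
    (hξ : ∀ c : H →L[ℂ] H, (∀ T ∈ M.commutant, c (T ξ) = 0) → c * q = 0)
    (S : Set (H →L[ℂ] H)) (hM : ∀ w ∈ S, w ∈ M) (hw : ∀ w ∈ S, w * star w * w = w)
    (hw0 : ∀ w ∈ S, w ≠ 0) (hSq : ∀ w ∈ S, w * q = w)
    (hSo : ∀ w ∈ S, ∀ w' ∈ S, w ≠ w' → star w * w' = 0) : S.Countable := by
  by_contra hS
  choose T hTS hTc hT using fun C : Set (H →L[ℂ] H) =>
    exists_countable_subset hξ (S \ C) (fun w h => hM w h.1) hq (fun w h => hSq w h.1)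
  let C : ℕ → Set (H →L[ℂ] H) := fun k => Nat.rec ∅ (fun _ C => C ∪ T C) k
  have hCs : ∀ k, C (k + 1) = C k ∪ T (C k) := fun k => rfl
  have hCc : ∀ k, (C k).Countable := fun k => by
    induction k with
    | zero => exact Set.countable_empty
    | succ k ih => exact ih.union (hTc _)
  have hCmono : Monotone C := monotone_nat_of_le_succ fun k => Set.subset_union_left
  obtain ⟨w, hwS, hwC⟩ : ∃ w ∈ S, w ∉ ⋃ k, C k := by
    by_contra! h
    exact hS ((Set.countable_iUnion hCc).mono h)
  have hdisj : ∀ j k, j < k → ∀ w ∈ T (C j), ∀ w' ∈ T (C k), w ≠ w' := by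
    rintro j k hjk w hj w' hk rfl
    exact (hTS _ hk).2 (hCmono (Nat.succ_le_of_lt hjk) (by rw [hCs]; exact Or.inr hj))
  have horth : ∀ j k, j ≠ k → ∀ w ∈ T (C j), ∀ w' ∈ T (C k), star w * w' = 0 := by
    intro j k hjk w hj w' hk
    refine hSo w (hTS _ hj).1 w' (hTS _ hk).1 ?_
    rcases lt_or_gt_of_ne hjk with h | h
    · exact hdisj j k h w hj w' hk
    · exact (hdisj k j h w' hk w hj).symm
  choose A hAM hA1 hA2 using fun k => exists_sum_countable (M := M) (hTc (C k))
    (fun w h => hM w (hTS _ h).1) (fun w h => hw w (hTS _ h).1)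
    (fun w h w' h' hne => hSo w (hTS _ h).1 w' (hTS _ h').1 hne)
  obtain ⟨g, hgdef⟩ : ∃ g, g = star w * w := ⟨_, rfl⟩
  have hg : IsStarProjection g := hgdef ▸ isStarProjection_star_mul (hw w hwS)
  have hgg : g * (1 - g) = 0 := by rw [mul_sub, mul_one, hg.isIdempotentElem.eq, sub_self]
  have hwg : w * g = w := by rw [hgdef, ← mul_assoc, hw w hwS]
  have hgM : g ∈ M := hgdef ▸ mul_mem (star_mem (hM w hwS)) (hM w hwS)
  choose u huM hu hu1 hu2 using fun k => exists_polar (M := M) (mul_mem (hAM k) hgM)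
  have huker : ∀ k b, u k * b = 0 ↔ g * b = 0 := fun k b => by
    rw [hu1, mul_assoc]
    refine ⟨fun h => ?_, fun h => by rw [h, mul_zero]⟩
    have := hT (C k) (g * b) (hA1 k _ h) w ⟨hwS, fun h => hwC (Set.mem_iUnion.2 ⟨k, h⟩)⟩
    rw [← mul_assoc, hwg] at this
    rw [hgdef, mul_assoc, this, mul_zero]
  have hug : ∀ k, u k * g = u k := fun k => by
    have := (huker k _).2 hgg
    rw [mul_sub, mul_one, sub_eq_zero] at this
    exact this.symm
  have huu : ∀ k, star (u k) * u k = g := fun k => by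
    have h1 : g * (1 - star (u k) * u k) = 0 := (huker k _).1 (by
      rw [mul_sub, mul_one, ← mul_assoc, hu, sub_self])
    rw [mul_sub, mul_one, sub_eq_zero] at h1
    have h2 := congrArg star h1
    rw [star_mul, star_mul, star_star, hg.isSelfAdjoint.star_eq, mul_assoc, hug] at h2
    exact h2.symm
  have huo : ∀ j k, j ≠ k → star (u j) * u k = 0 := fun j k hjk => by
    refine (hu2 k _).2 ?_
    rw [← mul_assoc, hA2 k, zero_mul]
    intro w' hw'
    refine star_eq_zero_of_star_mul ((hu2 j _).2 ?_)
    rw [← mul_assoc, hA2 j, zero_mul]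
    intro w'' hw''
    exact horth k j hjk.symm w' hw' w'' hw''
  have hRu : ∀ k, R * u k = u k := fun k => by
    have : (R - 1) * u k = 0 := (hu2 k _).2 (by
      rw [← mul_assoc, hA2 k, zero_mul]
      intro w' hw'
      have h1 := (hTS _ hw').1
      rw [sub_mul, commute_of_mem (hM w' h1) hR', one_mul, ← hSq w' h1, mul_assoc, hRq, sub_self])
    rwa [sub_mul, one_mul, sub_eq_zero] at this
  have h0 := hno _ (isSystem_of_ortho huM huu (hug 0) huo) fun k => by rw [← mul_assoc, hRu]
  have hu0 : u 0 = 0 := by rw [← hu 0, h0, zero_mul]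
  have hg0 : g = 0 := by rw [← huu 0, hu0, mul_zero]
  exact hw0 w hwS (by rw [← hwg, hg0, mul_zero])

theorem exists_countably_generated {M : VonNeumannAlgebra H} {R : H →L[ℂ] H}
    (hRM : R ∈ M) (hR' : R ∈ M.commutant) (hR : IsStarProjection R) (hR0 : R ≠ 0)
    (hno : ∀ v, IsSystem M v → (∀ k, R * v k = v k) → v 0 = 0) :
    ∃ c ∈ M, c ∈ M.commutant ∧ IsStarProjection c ∧ c ≠ 0 ∧ R * c = c ∧
      ∃ η : ℕ → H, ∀ d : H →L[ℂ] H, (∀ T ∈ M.commutant, ∀ i, d (T (η i)) = 0) → d * c = 0 := by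
  obtain ⟨ξ, hξR, hξ0⟩ : ∃ ξ, R ξ = ξ ∧ ξ ≠ 0 := by
    by_contra! h
    refine hR0 (ContinuousLinearMap.ext fun v => h (R v) ?_)
    rw [← clm_mul_apply, hR.isIdempotentElem.eq]
  have hXN : ∀ T ∈ M.commutant, ∀ v ∈ {v | ∃ T ∈ M.commutant, v = T ξ},
      T v ∈ {v | ∃ T ∈ M.commutant, v = T ξ} := by
    rintro T hT _ ⟨T', hT', rfl⟩
    exact ⟨T * T', mul_mem hT hT', rfl⟩
  obtain ⟨q, hq, hqX, hqs, hqc⟩ := exists_projection {v | ∃ T ∈ M.commutant, v = T ξ}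
  have hqM : q ∈ M := mem_of_commute fun T hT =>
    hqc T (hXN T hT) (hXN (star T) (star_mem hT))
  have hξs : ∀ c : H →L[ℂ] H, (∀ T ∈ M.commutant, c (T ξ) = 0) → c * q = 0 := fun c hc =>
    hqs c (by rintro _ ⟨T, hT, rfl⟩; exact hc T hT)
  have hqT : ∀ T ∈ M.commutant, q (T ξ) = T ξ := fun T hT => hqX _ ⟨T, hT, rfl⟩
  have hRq : R * q = q := by
    have := hξs (R - 1) fun T hT => by
      rw [sub_apply, ← clm_mul_apply, ← commute_of_mem hRM hT, clm_mul_apply, hξR,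
        one_apply_eq_self, sub_self]
    rwa [sub_mul, one_mul, sub_eq_zero] at this
  have hqR : q * R = q := mul_comm_of_eq hR hq hRq
  obtain ⟨S, hS, hSo, hmax⟩ := exists_maximal_pairwise
    (fun w : H →L[ℂ] H => w ∈ M ∧ w * star w * w = w ∧ w ≠ 0 ∧ w * q = w)
    (fun w w' => star w * w' = 0)
  have hSc : S.Countable := countable_of_no_system hR' hno hq hqR hξs S (fun w h => (hS w h).1)
    (fun w h => (hS w h).2.1) (fun w h => (hS w h).2.2.1) (fun w h => (hS w h).2.2.2)
    (fun w h w' h' hne => hSo h h' hne)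
  obtain ⟨c, hcM, hcM', hc, hcX, hcs⟩ := exists_central_support M _ hXN
  have hcξ : c ξ = ξ := hcX _ ⟨1, one_mem _, rfl⟩
  have hRc : R * c = c := by
    have := hcs (R - 1) (by
      rintro a ha _ ⟨T, hT, rfl⟩
      rw [sub_apply, ← clm_mul_apply, commute_of_mem ha hR', clm_mul_apply, ← clm_mul_apply R,
        ← commute_of_mem hRM hT, clm_mul_apply, hξR, one_apply_eq_self, sub_self])
    rwa [sub_mul, one_mul, sub_eq_zero] at this
  obtain ⟨η, hη⟩ := ((hSc.image fun w => w ξ).insert 0).exists_eq_range (Set.insert_nonempty _ _)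
  refine ⟨c, hcM, hcM', hc, ?_, hRc, η, fun d hd => hcs d ?_⟩
  · rintro rfl
    exact hξ0 hcξ.symm
  have hd' : ∀ T ∈ M.commutant, ∀ w ∈ S, d (T (w ξ)) = 0 := fun T hT w hw => by
    obtain ⟨i, hi⟩ : w ξ ∈ Set.range η := by
      rw [← hη]
      exact Or.inr ⟨w, hw, rfl⟩
    rw [← hi]
    exact hd T hT i
  have hYN : ∀ T ∈ M.commutant, ∀ v ∈ {v | ∃ T ∈ M.commutant, ∃ w ∈ S, v = T (w ξ)},
      T v ∈ {v | ∃ T ∈ M.commutant, ∃ w ∈ S, v = T (w ξ)} := by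
    rintro T hT _ ⟨T', hT', w, hw, rfl⟩
    exact ⟨T * T', mul_mem hT hT', w, hw, rfl⟩
  obtain ⟨f, hf, hfX, hfs, hfc⟩ :=
    exists_projection {v | ∃ T ∈ M.commutant, ∃ w ∈ S, v = T (w ξ)}
  have hfM : f ∈ M := mem_of_commute fun T hT =>
    hfc T (hYN T hT) (hYN (star T) (star_mem hT))
  have hdf : d * f = 0 := hfs d (by
    rintro _ ⟨T, hT, w, hw, rfl⟩
    exact hd' T hT w hw)
  have hfw : ∀ w ∈ S, star w * (1 - f) = 0 := fun w hw => by
    have h1 : (1 - f) * w * q = 0 := hξs _ fun T hT => by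
      rw [← clm_mul_apply, mul_assoc, ← commute_of_mem (hS w hw).1 hT, clm_mul_apply,
        clm_mul_apply, sub_apply, hfX _ ⟨T, hT, w, hw, rfl⟩, one_apply_eq_self, sub_self]
    rw [mul_assoc, (hS w hw).2.2.2] at h1
    have := congrArg star h1
    rwa [star_mul, star_sub, star_one, hf.isSelfAdjoint.star_eq, star_zero] at this
  have hfa : ∀ a ∈ M, (1 - f) * a * q = 0 := fun a ha => by
    obtain ⟨u, huM, hu, hu1, hu2⟩ := exists_polar (M := M)
      (mul_mem (mul_mem (sub_mem (one_mem M) hfM) ha) hqM)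
    by_contra hne
    have hu0 : u ≠ 0 := fun h => hne (by
      have := (hu1 1).1 (by rw [h, zero_mul])
      rwa [mul_one] at this)
    have huq : u * q = u := by
      have : u * (1 - q) = 0 := (hu1 _).2 (by
        rw [mul_assoc, mul_sub, mul_one, hq.isIdempotentElem.eq, sub_self, mul_zero])
      rw [mul_sub, mul_one, sub_eq_zero] at this
      exact this.symm
    have hwu : ∀ w ∈ S, star w * u = 0 := fun w hw => (hu2 _).2 (by
      rw [← mul_assoc, ← mul_assoc, hfw w hw, zero_mul, zero_mul])
    have huS : u ∈ S := hmax u ⟨huM, hu, hu0, huq⟩ fun w hw =>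
      ⟨hwu w hw, star_eq_zero_of_star_mul (hwu w hw)⟩
    exact hu0 (eq_zero_of_star_mul (hwu u huS))
  rintro a ha _ ⟨T, hT, rfl⟩
  have h1 := congrArg (fun b : H →L[ℂ] H => d (b (T ξ))) (hfa a ha)
  simp only [clm_mul_apply, hqT T hT, sub_apply, one_apply_eq_self, map_sub, zero_apply,
    map_zero] at h1
  have h2 : d (f (a (T ξ))) = 0 := by rw [← clm_mul_apply, hdf, zero_apply]
  rwa [h2, sub_zero] at h1

omit [CompleteSpace H] in
theorem tendsto_apply_of_sigmaStrong {ι : Type*} {l : Filter ι} {xs : ι → H →L[ℂ] H}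
    {x : H →L[ℂ] H} (h : SigmaStrongTendsto l xs x) (v : H) :
    Tendsto (fun i => xs i v) l (nhds (x v)) := by
  have hs : ∀ j, j ≠ 0 → (if j = 0 then v else 0) = (0 : H) := fun j hj => if_neg hj
  have h1 := h (fun j => if j = 0 then v else 0)
    (summable_of_ne_finset_zero (s := {0}) fun j hj => by
      rw [hs j (by simpa using hj), norm_zero, zero_pow two_ne_zero])
  have h2 : ∀ i, ∑' j : ℕ, ‖xs i (if j = 0 then v else 0) - x (if j = 0 then v else 0)‖ ^ 2 =
      ‖xs i v - x v‖ ^ 2 := fun i => by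
    rw [tsum_eq_single 0 fun j hj => by
      rw [hs j hj, map_zero, map_zero, sub_zero, norm_zero, zero_pow two_ne_zero], if_pos rfl]
  simp only [h2] at h1
  rw [tendsto_iff_norm_sub_tendsto_zero]
  simpa [Real.sqrt_sq, norm_nonneg] using h1.sqrt

theorem exists_strong_sequence {ι : Type*} {l : Filter ι} [l.NeBot] {xs : ι → H →L[ℂ] H}
    {x : H →L[ℂ] H} (h : ∀ v, Tendsto (fun i => xs i v) l (nhds (x v)))
    (h' : ∀ v, Tendsto (fun i => star (xs i) v) l (nhds (star x v))) (η : ℕ → H) :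
    ∃ α : ℕ → ι, ∀ i, Tendsto (fun k => xs (α k) (η i)) atTop (nhds (x (η i))) ∧
      Tendsto (fun k => star (xs (α k)) (η i)) atTop (nhds (star x (η i))) := by
  have hex : ∀ k : ℕ, ∃ α, ∀ i ∈ Finset.range (k + 1),
      dist (xs α (η i)) (x (η i)) < 1 / (k + 1 : ℝ) ∧
        dist (star (xs α) (η i)) (star x (η i)) < 1 / (k + 1 : ℝ) := fun k => by
    refine Filter.Eventually.exists (f := l) ?_
    rw [Filter.eventually_all_finset]
    intro i _
    have hk : (0 : ℝ) < 1 / (k + 1 : ℝ) := by positivity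
    exact (Metric.tendsto_nhds.1 (h (η i)) _ hk).and (Metric.tendsto_nhds.1 (h' (η i)) _ hk)
  choose α hα using hex
  refine ⟨α, fun i => ⟨?_, ?_⟩⟩
  · refine tendsto_iff_dist_tendsto_zero.2 (squeeze_zero' (.of_forall fun _ => dist_nonneg) ?_
      tendsto_one_div_add_atTop_nhds_zero_nat)
    filter_upwards [eventually_ge_atTop i] with k hk
    exact (hα k i (Finset.mem_range.2 (Nat.lt_succ_of_le hk))).1.le
  · refine tendsto_iff_dist_tendsto_zero.2 (squeeze_zero' (.of_forall fun _ => dist_nonneg) ?_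
      tendsto_one_div_add_atTop_nhds_zero_nat)
    filter_upwards [eventually_ge_atTop i] with k hk
    exact (hα k i (Finset.mem_range.2 (Nat.lt_succ_of_le hk))).2.le

theorem good_of_countably_generated {M : VonNeumannAlgebra H} {n : ℕ} {x c : H →L[ℂ] H}
    (hx : x ∈ M) {ι : Type*} {l : Filter ι} [l.NeBot] {xs : ι → H →L[ℂ] H}
    (hmem : ∀ i, xs i ∈ M) {C B : ℝ} (hbdd : ∀ i, ‖xs i‖ ≤ C) (hCB : C ≤ B)
    (hdiv : ∀ i, NDivisible M n (xs i))
    (h : ∀ v, Tendsto (fun i => xs i v) l (nhds (x v)))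
    (h' : ∀ v, Tendsto (fun i => star (xs i) v) l (nhds (star x v)))
    (hcM : c ∈ M) (hcM' : c ∈ M.commutant) (hc : IsStarProjection c) {η : ℕ → H}
    (hη : ∀ d : H →L[ℂ] H, (∀ T ∈ M.commutant, ∀ i, d (T (η i)) = 0) → d * c = 0) :
    Good M n x B c := by
  obtain ⟨α, hα⟩ := exists_strong_sequence h h' η
  choose φ hφM hφ using fun k => hdiv (α k)
  have htot : ∀ d : H →L[ℂ] H, (∀ v ∈ {v | ∃ T ∈ M.commutant, ∃ i, v = T (η i)}, d v = 0) →
      d * c = 0 := fun d hd => hη d fun T hT i => hd _ ⟨T, hT, i, rfl⟩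
  refine ⟨hcM, hcM', hc, fun k => xs (α k), fun k => (φ k).toNonUnitalStarAlgHom,
    fun k => hmem _, fun k => (hbdd _).trans hCB, hφM, fun k => ?_, fun k T => ?_,
    tendsto_of_total (fun k => hbdd _) htot ?_, tendsto_of_total (B := C) (fun k => ?_) htot ?_⟩
  · change φ k 1 * c = c
    rw [map_one, one_mul]
  · exact congrArg (· * c) (hφ k T)
  · rintro _ ⟨T, hT, i, rfl⟩
    have := (T.continuous.tendsto _).comp (hα i).1
    have h1 : ∀ y ∈ M, T (y (η i)) = y (T (η i)) := fun y hy => by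
      rw [← clm_mul_apply, commute_of_mem hy hT, clm_mul_apply]
    rw [h1 x hx] at this
    exact this.congr fun k => h1 _ (hmem _)
  · rw [norm_star]
    exact hbdd _
  · rintro _ ⟨T, hT, i, rfl⟩
    have := (T.continuous.tendsto _).comp (hα i).2
    have h1 : ∀ y ∈ M, T (y (η i)) = y (T (η i)) := fun y hy => by
      rw [← clm_mul_apply, commute_of_mem hy hT, clm_mul_apply]
    rw [h1 _ (star_mem hx)] at this
    exact this.congr fun k => h1 _ (star_mem (hmem _))

/-- Central projections on which `x` is well approximated add up to the identity. -/
theorem exists_good_partition {M : VonNeumannAlgebra H} {n : ℕ} (hn : 0 < n) {x : H →L[ℂ] H}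
    (hx : x ∈ M) {ι : Type*} {l : Filter ι} [l.NeBot] {xs : ι → H →L[ℂ] H}
    (hmem : ∀ i, xs i ∈ M) {C B : ℝ} (hbdd : ∀ i, ‖xs i‖ ≤ C) (hCB : C ≤ B) (hB : n * ‖x‖ ≤ B)
    (hdiv : ∀ i, NDivisible M n (xs i))
    (h : ∀ v, Tendsto (fun i => xs i v) l (nhds (x v)))
    (h' : ∀ v, Tendsto (fun i => star (xs i) v) l (nhds (star x v))) :
    ∃ Z : Set (H →L[ℂ] H), (∀ z ∈ Z, Good M n x B z) ∧ (Z.Pairwise fun e f => e * f = 0) ∧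
      ∀ b : H →L[ℂ] H, (∀ z ∈ Z, b * z = 0) → b = 0 := by
  obtain ⟨Z, hZ, hZo, hmax⟩ := exists_maximal_pairwise (Good M n x B) (fun e f => e * f = 0)
  obtain ⟨q, hqM, hq, hqZ, hqs⟩ := exists_sup_projection (M := M) (fun z : Z => z.1)
    fun z => (hZ z z.2).1
  have hqM' : q ∈ M.commutant := by
    have h1 : ∀ T ∈ M, T * q = q * T * q := fun T hT => by
      have := hqs ((1 - q) * T) fun z => by
        rw [mul_assoc, ← commute_of_mem hT (hZ z z.2).2.1, ← mul_assoc, sub_mul, hqZ, one_mul,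
          sub_self, zero_mul]
      rwa [sub_mul, sub_mul, one_mul, sub_eq_zero] at this
    refine VonNeumannAlgebra.mem_commutant_iff.2 fun T hT => ?_
    have h2 := congrArg star (h1 (star T) (star_mem hT))
    simp only [star_mul, star_star, hq.isSelfAdjoint.star_eq] at h2
    rw [h1 T hT, mul_assoc]
    exact h2.symm
  obtain ⟨t, e, P, ht, hP', hno⟩ := exists_tower M
  have hRM : 1 - q ∈ M := sub_mem (one_mem M) hqM
  have hRM' : 1 - q ∈ M.commutant := sub_mem (one_mem _) hqM'
  have hR : IsStarProjection (1 - q) := hq.one_sub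
  have hRZ : ∀ z ∈ Z, (1 - q) * z = 0 := fun z hz => by
    rw [sub_mul, hqZ ⟨z, hz⟩, one_mul, sub_self]
  have hnone : ∀ c, Good M n x B c → (1 - q) * c = c → c = 0 := fun c hc hRc => by
    have hcz : ∀ z ∈ Z, z * c = 0 := fun z hz => by
      rw [← hRc, ← mul_assoc, commute_of_mem hRM (hZ z hz).2.1, hRZ z hz, zero_mul]
    have hcZ : c ∈ Z := hmax c hc fun z hz => ⟨hcz z hz, by
      rw [commute_of_mem (hZ z hz).1 hc.2.1, hcz z hz]⟩
    rw [← hc.2.2.1.isIdempotentElem.eq, hcz c hcZ]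
  have hPR : (1 - q) * P = 0 := by
    have hcomm : Commute (1 - q) P := (commute_of_mem hRM hP').symm
    have hcomm' : (1 - q) * P = P * (1 - q) := hcomm
    have hPRp : IsStarProjection ((1 - q) * P) := ⟨hR.isIdempotentElem.mul_of_commute hcomm
      ht.proj'.isIdempotentElem, by
        rw [isSelfAdjoint_iff, star_mul, hR.isSelfAdjoint.star_eq, ht.proj'.isSelfAdjoint.star_eq,
          hcomm']⟩
    refine hnone _ ((good_of_tower ht hP' hn hx hB).mono (mul_mem hRM ht.mem')
      (mul_mem hRM' hP') hPRp ?_) ?_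
    · rw [hcomm', ← mul_assoc, ht.proj'.isIdempotentElem.eq]
    · rw [← mul_assoc, hR.isIdempotentElem.eq]
  have hR0 : 1 - q = 0 := by
    by_contra hne
    obtain ⟨c, hcM, hcM', hc, hc0, hRc, η, hη⟩ := exists_countably_generated hRM hRM' hR hne
      fun v hv hRv => hno v hv fun k => by
        rw [← hRv, ← mul_assoc, commute_of_mem hRM hP', hPR, zero_mul]
    exact hc0 (hnone c (good_of_countably_generated hx hmem hbdd hCB hdiv h h' hcM hcM' hc hη) hRc)
  refine ⟨Z, hZ, hZo, fun b hb => ?_⟩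
  have := hqs b fun z => hb z z.2
  rwa [← sub_eq_zero.1 hR0, mul_one] at this

theorem exists_glue {M : VonNeumannAlgebra H} {Z : Set (H →L[ℂ] H)}
    (hZM : ∀ z ∈ Z, z ∈ M) (hZM' : ∀ z ∈ Z, z ∈ M.commutant) (hZp : ∀ z ∈ Z, IsStarProjection z)
    (hZo : Z.Pairwise fun e f => e * f = 0) {B : ℝ} (hB : 0 ≤ B) (a : Z → H →L[ℂ] H)
    (haM : ∀ z, a z ∈ M) (ha : ∀ z, ‖a z‖ ≤ B) :
    ∃ A ∈ M, ‖A‖ ≤ B ∧ ∀ z : Z, A * z = a z * z := by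
  have hidem : ∀ z : Z, z.1 * z.1 = z.1 := fun z => (hZp z z.2).isIdempotentElem.eq
  have hort : ∀ i j : Z, i ≠ j → i.1 * j.1 = 0 := fun i j hij =>
    hZo i.2 j.2 fun h => hij (Subtype.ext h)
  obtain ⟨A, hA, hs, -⟩ := exists_hasSum (fun z : Z => a z * z.1) (fun z => z.1) (fun z => z.1) hB
    (fun z => hZp z z.2) hort (fun z => hZp z z.2) hort
    (fun z => by rw [mul_assoc, hidem])
    (fun z => by rw [← mul_assoc, commute_of_mem (haM z) (hZM' z z.2), mul_assoc, hidem])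
    (fun z => (norm_mul_le _ _).trans ((mul_le_mul (ha z)
      (norm_le_one_of_isStarProjection (hZp z z.2)) (norm_nonneg _) hB).trans_eq (mul_one B)))
  refine ⟨A, hasSum_mem (fun z => mul_mem (haM z) (hZM z z.2)) hs, hA, fun z => ?_⟩
  ext v
  refine (hs (z.1 v)).unique ?_
  have h0 : ∀ w : Z, w ≠ z → (a w * w.1) (z.1 v) = 0 := fun w hw => by
    rw [← clm_mul_apply, mul_assoc, hort w z hw, mul_zero, zero_apply]
  have := hasSum_single z h0
  rwa [← clm_mul_apply (a z * z.1), mul_assoc, hidem] at this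

omit [CompleteSpace H] in
theorem eq_of_total {Z : Set (H →L[ℂ] H)} (hZ : ∀ b : H →L[ℂ] H, (∀ z ∈ Z, b * z = 0) → b = 0)
    {a b : H →L[ℂ] H} (h : ∀ z : Z, a * z = b * z) : a = b :=
  sub_eq_zero.1 (hZ _ fun z hz => by rw [sub_mul, h ⟨z, hz⟩, sub_self])

open scoped Matrix.Norms.L2Operator in
theorem exists_norm_apply_le {n : ℕ} (T : Matrix (Fin n) (Fin n) ℂ) :
    ∃ B : ℝ, 0 ≤ B ∧ ∀ φ : Matrix (Fin n) (Fin n) ℂ →⋆ₙₐ[ℂ] (H →L[ℂ] H), ‖φ T‖ ≤ B :=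
  ⟨‖T‖, norm_nonneg _, fun φ => NonUnitalStarAlgHom.norm_apply_le φ T⟩

theorem exists_glue_hom {M : VonNeumannAlgebra H} {n : ℕ} {Z : Set (H →L[ℂ] H)}
    (hZM : ∀ z ∈ Z, z ∈ M) (hZM' : ∀ z ∈ Z, z ∈ M.commutant) (hZp : ∀ z ∈ Z, IsStarProjection z)
    (hZo : Z.Pairwise fun e f => e * f = 0)
    (hZ : ∀ b : H →L[ℂ] H, (∀ z ∈ Z, b * z = 0) → b = 0)
    (φ : Z → Matrix (Fin n) (Fin n) ℂ →⋆ₙₐ[ℂ] (H →L[ℂ] H)) (hφ : ∀ z T, φ z T ∈ M)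
    (hφ1 : ∀ z : Z, φ z 1 * z = z) :
    ∃ Φ : Matrix (Fin n) (Fin n) ℂ →⋆ₐ[ℂ] (H →L[ℂ] H), (∀ T, Φ T ∈ M) ∧
      ∀ T (z : Z), Φ T * z = φ z T * z := by
  have hex : ∀ T, ∃ A ∈ M, ∀ z : Z, A * z = φ z T * z := fun T => by
    obtain ⟨B, hB, hle⟩ := exists_norm_apply_le (H := H) T
    obtain ⟨A, hA, -, h⟩ := exists_glue hZM hZM' hZp hZo hB (fun z => φ z T) (fun z => hφ z T)
      fun z => hle _
    exact ⟨A, hA, h⟩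
  choose F hFM hF using hex
  have hcomm : ∀ (z : Z), ∀ a ∈ M, z.1 * a = a * z := fun z a ha => commute_of_mem ha (hZM' z z.2)
  have hr : ∀ r : ℂ, F (algebraMap ℂ (Matrix (Fin n) (Fin n) ℂ) r) = algebraMap ℂ (H →L[ℂ] H) r :=
    fun r => eq_of_total hZ fun z => by
      rw [hF, Algebra.algebraMap_eq_smul_one, Algebra.algebraMap_eq_smul_one, map_smul,
        smul_mul_assoc, smul_mul_assoc, hφ1, one_mul]
  have hadd : ∀ S T, F (S + T) = F S + F T := fun S T => eq_of_total hZ fun z => by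
    rw [hF, map_add, add_mul, add_mul, hF, hF]
  have hmul : ∀ S T, F (S * T) = F S * F T := fun S T => eq_of_total hZ fun z => by
    rw [hF, map_mul, mul_assoc, mul_assoc, hF, ← hcomm z _ (hφ z T), ← mul_assoc, ← mul_assoc, hF]
  have hstar : ∀ T, F (star T) = star (F T) := fun T => eq_of_total hZ fun z => by
    have h := congrArg star (hF T z)
    rw [star_mul, star_mul, (hZp z z.2).isSelfAdjoint.star_eq, hcomm z _ (star_mem (hFM T)),
      hcomm z _ (star_mem (hφ z T))] at h
    rw [hF, map_star, h]
  refine ⟨{ toFun := F, map_one' := ?_, map_mul' := hmul, map_zero' := ?_, map_add' := hadd,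
            commutes' := hr, map_star' := hstar }, hFM, hF⟩
  · simpa using hr 1
  · simpa using hr 0

/-- The approximation on each piece of a central partition globalizes. -/
theorem exists_sequence_of_partition {M : VonNeumannAlgebra H} {n : ℕ} {x : H →L[ℂ] H}
    {B : ℝ} (hB : 0 ≤ B) {Z : Set (H →L[ℂ] H)} (hgood : ∀ z ∈ Z, Good M n x B z)
    (hZo : Z.Pairwise fun e f => e * f = 0)
    (hZ : ∀ b : H →L[ℂ] H, (∀ z ∈ Z, b * z = 0) → b = 0) :
    ∃ a : ℕ → H →L[ℂ] H, (∀ k, a k ∈ M) ∧ (∀ k, ‖a k‖ ≤ B) ∧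
      (∀ k, NDivisible M n (a k)) ∧
      (∀ v, Tendsto (fun k => a k v) atTop (nhds (x v))) ∧
      ∀ v, Tendsto (fun k => star (a k) v) atTop (nhds (star x v)) := by
  have hZM : ∀ z ∈ Z, z ∈ M := fun z hz => (hgood z hz).1
  have hZM' : ∀ z ∈ Z, z ∈ M.commutant := fun z hz => (hgood z hz).2.1
  have hZp : ∀ z ∈ Z, IsStarProjection z := fun z hz => (hgood z hz).2.2.1
  choose b φ hbM hb hφM hφ1 hφ hlim hlim' using fun z : Z => (hgood z z.2).2.2.2
  choose a haM ha hab using fun k => exists_glue hZM hZM' hZp hZo hB (fun z => b z k)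
    (fun z => hbM z k) fun z => hb z k
  choose Φ hΦM hΦ using fun k => exists_glue_hom hZM hZM' hZp hZo hZ (fun z => φ z k)
    (fun z => hφM z k) fun z => hφ1 z k
  have hcomm : ∀ (z : Z), ∀ a ∈ M, z.1 * a = a * z := fun z a ha => commute_of_mem ha (hZM' z z.2)
  have htot : ∀ d : H →L[ℂ] H, (∀ v ∈ {v | ∃ z : Z, ∃ w, v = z.1 w}, d v = 0) → d * 1 = 0 :=
    fun d hd => by
      rw [mul_one]
      refine hZ d fun z hz => ?_
      ext w
      exact hd _ ⟨⟨z, hz⟩, w, rfl⟩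
  refine ⟨a, haM, ha, fun k => ⟨Φ k, hΦM k, fun T => eq_of_total hZ fun z => ?_⟩,
    tendsto_of_total ha htot ?_, tendsto_of_total (B := B) (fun k => ?_) htot ?_⟩
  · rw [mul_assoc, mul_assoc, hab, hΦ, ← hcomm z _ (hbM z k), ← hcomm z _ (hφM z k T),
      ← mul_assoc, ← mul_assoc, hΦ, hab, mul_assoc, mul_assoc, hcomm z _ (hbM z k),
      hcomm z _ (hφM z k T), ← mul_assoc, ← mul_assoc, hφ]
  · rintro _ ⟨z, w, rfl⟩
    refine (hlim z w).congr fun k => ?_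
    rw [← clm_mul_apply, ← hab, clm_mul_apply]
  · rw [norm_star]
    exact ha k
  · rintro _ ⟨z, w, rfl⟩
    refine (hlim' z w).congr fun k => ?_
    have h := congrArg star (hab k z)
    rw [star_mul, star_mul, (hZp z z.2).isSelfAdjoint.star_eq, hcomm z _ (star_mem (haM k)),
      hcomm z _ (star_mem (hbM z k))] at h
    rw [← clm_mul_apply, ← h, clm_mul_apply]

omit [CompleteSpace H] in
theorem starProjection_apply_comm (S : Submodule ℂ H) [S.HasOrthogonalProjection]
    {b b' : H →L[ℂ] H} (hadj : ∀ v w, inner ℂ (b' v) w = inner ℂ v (b w))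
    (hb : ∀ v ∈ S, b v ∈ S) (hb' : ∀ v ∈ S, b' v ∈ S) (v : H) :
    S.starProjection (b v) = b (S.starProjection v) := by
  refine Submodule.eq_starProjection_of_mem_orthogonal (hb _ (S.starProjection_apply_mem v)) ?_
  rw [← map_sub]
  intro s hs
  rw [← hadj]
  exact S.sub_starProjection_mem_orthogonal v _ (hb' s hs)

section Amplification

variable {ι : Type*}

omit [InnerProductSpace ℂ H] [CompleteSpace H] in
theorem lp_hasSum_norm_sq (f : lp (fun _ : ι => H) 2) : HasSum (fun i => ‖f i‖ ^ 2) (‖f‖ ^ 2) := by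
  have := lp.hasSum_norm (by norm_num) f
  simpa using this

omit [InnerProductSpace ℂ H] [CompleteSpace H] in
theorem memℓp_two {ξ : ι → H} (hξ : Summable fun i => ‖ξ i‖ ^ 2) : Memℓp ξ 2 :=
  memℓp_gen (by simpa using hξ)

/-- The diagonal action of an operator on square summable families. -/
noncomputable def amp (ι : Type*) (a : H →L[ℂ] H) :
    lp (fun _ : ι => H) 2 →L[ℂ] lp (fun _ : ι => H) 2 :=
  lp.mapCLM 2 (fun _ => a) (norm_nonneg a) fun _ => le_rfl

omit [CompleteSpace H] in
theorem amp_apply (a : H →L[ℂ] H) (f : lp (fun _ : ι => H) 2) (i : ι) : amp ι a f i = a (f i) :=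
  rfl

theorem inner_amp_star (a : H →L[ℂ] H) (f g : lp (fun _ : ι => H) 2) :
    inner ℂ (amp ι (star a) f) g = inner ℂ f (amp ι a g) := by
  simp only [lp.inner_eq_tsum, amp_apply, inner_star_left]

/-- The double commutant theorem for the diagonal action. -/
theorem amp_mem_closure (A : StarSubalgebra ℂ (H →L[ℂ] H)) {y : H →L[ℂ] H}
    (hy : ∀ T : H →L[ℂ] H, (∀ a ∈ A, T * a = a * T) → T * y = y * T)
    (v : lp (fun _ : ι => H) 2) : amp ι y v ∈ closure {w | ∃ a ∈ A, w = amp ι a v} := by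
  classical
  let L : (H →L[ℂ] H) →ₗ[ℂ] lp (fun _ : ι => H) 2 :=
    { toFun := fun a => amp ι a v
      map_add' := fun a b => by ext i; rfl
      map_smul' := fun c a => by ext i; rfl }
  let S : Submodule ℂ (lp (fun _ : ι => H) 2) :=
    (A.toSubalgebra.toSubmodule.map L).topologicalClosure
  have hSA : ∀ a ∈ A, ∀ w ∈ S, amp ι a w ∈ S := fun a ha w hw => by
    refine map_mem_closure (amp ι a).continuous hw ?_
    rintro _ ⟨b, hb, rfl⟩
    have hab : a * b ∈ A := mul_mem ha hb
    exact ⟨a * b, hab, by ext i; rfl⟩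
  have hP : ∀ a ∈ A, ∀ w, S.starProjection (amp ι a w) = amp ι a (S.starProjection w) :=
    fun a ha => starProjection_apply_comm S (inner_amp_star a) (hSA a ha)
      (hSA _ (star_mem ha))
  have hentry : ∀ i j (w : H), S.starProjection (lp.single 2 j (y w)) i =
      y (S.starProjection (lp.single 2 j w) i) := fun i j w => by
    have := hy ((lp.evalCLM ℂ (fun _ : ι => H) 2 i) ∘L S.starProjection ∘L
      (lp.singleContinuousLinearMap ℂ (fun _ : ι => H) 2 j)) fun a ha => by
        ext w
        change S.starProjection (lp.single 2 j (a w)) i = a (S.starProjection (lp.single 2 j w) i)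
        have h1 : lp.single 2 j (a w) = amp ι a (lp.single 2 j w) := by
          ext k
          rw [amp_apply]
          by_cases h : k = j
          · subst h; simp
          · simp [h]
        rw [h1, hP a ha, amp_apply]
    exact DFunLike.congr_fun this w
  have hPy : ∀ w, S.starProjection (amp ι y w) = amp ι y (S.starProjection w) := fun w => by
    ext i
    have h1 := ((lp.hasSum_single (by simp) (amp ι y w)).mapL S.starProjection).mapL
      (lp.evalCLM ℂ (fun _ : ι => H) 2 i)
    have h2 := ((((lp.hasSum_single (by simp) w)).mapL S.starProjection).mapL
      (lp.evalCLM ℂ (fun _ : ι => H) 2 i)).mapL y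
    refine h1.unique ?_
    convert h2 using 2 with j
    · exact hentry i j (w j)
    · rfl
  have hv : v ∈ S := subset_closure ⟨1, one_mem A, by ext i; rfl⟩
  have hmem := S.starProjection_apply_mem (amp ι y v)
  rw [hPy, Submodule.starProjection_eq_self_iff.2 hv] at hmem
  refine closure_mono ?_ hmem
  rintro _ ⟨a, ha, rfl⟩
  exact ⟨a, ha, rfl⟩

end Amplification

section StarApproximation

variable {ι : Type*}

/-- The operator acting as `a` on the first summand and as `star a` on the second one. -/
noncomputable def starAmp (ι : Type*) (a : H →L[ℂ] H) :
    lp (fun _ : ι ⊕ ι => H) 2 →L[ℂ] lp (fun _ : ι ⊕ ι => H) 2 :=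
  lp.mapCLM 2 (Sum.elim (fun _ => a) fun _ => star a) (norm_nonneg a) fun s => by
    cases s
    · exact le_rfl
    · exact (norm_star a).le

theorem starAmp_inr (a : H →L[ℂ] H) (f : lp (fun _ : ι ⊕ ι => H) 2) (i : ι) :
    starAmp ι a f (Sum.inr i) = star a (f (Sum.inr i)) :=
  rfl

theorem starAmp_mem_closure (A : StarSubalgebra ℂ (H →L[ℂ] H)) {y : H →L[ℂ] H}
    (hy : ∀ T : H →L[ℂ] H, (∀ a ∈ A, T * a = a * T) → T * y = y * T)
    (f : lp (fun _ : ι ⊕ ι => H) 2) :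
    starAmp ι y f ∈ closure {w | ∃ a ∈ A, w = starAmp ι a f} := by
  let L : (H →L[ℂ] H) →ₗ[ℝ] lp (fun _ : ι ⊕ ι => H) 2 :=
    { toFun := fun a => starAmp ι a f
      map_add' := fun a b => by
        ext s
        cases s
        · rfl
        · change star (a + b) _ = star a _ + star b _
          rw [star_add, add_apply]
      map_smul' := fun c a => by
        ext s
        cases s
        · rfl
        · change star (c • a) _ = c • star a _
          rw [star_smul, star_trivial, smul_apply] }
  let R : Submodule ℝ (lp (fun _ : ι ⊕ ι => H) 2) :=
    (A.toSubalgebra.toSubmodule.restrictScalars ℝ).map L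
  have hR : (R : Set (lp (fun _ : ι ⊕ ι => H) 2)) = {w | ∃ a ∈ A, w = starAmp ι a f} := by
    ext w
    constructor
    · rintro ⟨a, ha, rfl⟩
      exact ⟨a, ha, rfl⟩
    · rintro ⟨a, ha, rfl⟩
      exact ⟨a, ha, rfl⟩
  rw [← hR]
  by_contra hnot
  obtain ⟨φ, u, hlt, hu⟩ := RCLike.geometric_hahn_banach_closed_point (𝕜 := ℂ)
    R.convex.closure isClosed_closure hnot
  have hu0 : 0 < u := by simpa using hlt 0 (subset_closure R.zero_mem)
  have hφ0 : ∀ a ∈ A, RCLike.re (φ (starAmp ι a f)) = 0 := fun a ha => by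
    by_contra hne
    have hmem : ((u / RCLike.re (φ (starAmp ι a f))) • starAmp ι a f) ∈ R :=
      R.smul_mem _ ⟨a, ha, rfl⟩
    have h1 := hlt _ (subset_closure hmem)
    have h2 : φ ((u / RCLike.re (φ (starAmp ι a f))) • starAmp ι a f) =
        ((u / RCLike.re (φ (starAmp ι a f)) : ℝ) : ℂ) • φ (starAmp ι a f) :=
      map_smul φ ((u / RCLike.re (φ (starAmp ι a f)) : ℝ) : ℂ) (starAmp ι a f)
    rw [h2, smul_eq_mul, RCLike.re_eq_complex_re, Complex.re_ofReal_mul] at h1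
    rw [RCLike.re_eq_complex_re] at hne
    rw [div_mul_cancel₀ _ hne] at h1
    exact lt_irrefl _ h1
  obtain ⟨g, hg⟩ : ∃ g, ∀ w, φ w = inner ℂ g w :=
    ⟨(InnerProductSpace.toDual ℂ _).symm φ, fun w => by simp⟩
  have hsq : ∀ h : lp (fun _ : ι ⊕ ι => H) 2,
      Summable fun s => ‖h s‖ ^ 2 := fun h => (lp_hasSum_norm_sq h).summable
  let v : lp (fun _ : ι ⊕ ι => H) 2 := ⟨Sum.elim (fun i => f (Sum.inl i)) fun i => g (Sum.inr i),
    memℓp_two (Summable.sum _ ((hsq f).comp_injective Sum.inl_injective)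
      ((hsq g).comp_injective Sum.inr_injective))⟩
  let w : lp (fun _ : ι ⊕ ι => H) 2 := ⟨Sum.elim (fun i => g (Sum.inl i)) fun i => f (Sum.inr i),
    memℓp_two (Summable.sum _ ((hsq g).comp_injective Sum.inl_injective)
      ((hsq f).comp_injective Sum.inr_injective))⟩
  have key : ∀ a : H →L[ℂ] H,
      (inner ℂ w (amp (ι ⊕ ι) a v)).re = RCLike.re (φ (starAmp ι a f)) := fun a => by
    rw [hg, RCLike.re_eq_complex_re]
    refine (Complex.hasSum_re (lp.hasSum_inner w (amp (ι ⊕ ι) a v))).unique ?_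
    convert Complex.hasSum_re (lp.hasSum_inner g (starAmp ι a f)) using 2 with s
    cases s with
    | inl i => rfl
    | inr i =>
      rw [starAmp_inr, inner_star_right, ← inner_conj_symm, Complex.conj_re]
      rfl
  have hzero : (inner ℂ w (amp (ι ⊕ ι) y v)).re = 0 := by
    have hc : IsClosed {z : lp (fun _ : ι ⊕ ι => H) 2 | (inner ℂ w z).re = 0} :=
      isClosed_eq (by fun_prop) continuous_const
    refine closure_minimal ?_ hc (amp_mem_closure A hy v)
    rintro _ ⟨a, ha, rfl⟩
    exact (key a).trans (hφ0 a ha)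
  rw [key] at hzero
  linarith

/-- The `σ`-strong-* form of the double commutant theorem. -/
theorem exists_approx (A : StarSubalgebra ℂ (H →L[ℂ] H)) {y : H →L[ℂ] H}
    (hy : ∀ T : H →L[ℂ] H, (∀ a ∈ A, T * a = a * T) → T * y = y * T)
    {ξ : ι → H} (hξ : Summable fun i => ‖ξ i‖ ^ 2) {ε : ℝ} (hε : 0 < ε) :
    ∃ a ∈ A, ∑' i, ‖a (ξ i) - y (ξ i)‖ ^ 2 < ε ∧
      ∑' i, ‖star a (ξ i) - star y (ξ i)‖ ^ 2 < ε := by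
  let f : lp (fun _ : ι ⊕ ι => H) 2 := ⟨Sum.elim ξ ξ, memℓp_two (Summable.sum _ hξ hξ)⟩
  obtain ⟨_, ⟨a, ha, rfl⟩, hdist⟩ := Metric.mem_closure_iff.1 (starAmp_mem_closure A hy f) _
    (Real.sqrt_pos.2 hε)
  rw [dist_comm, dist_eq_norm] at hdist
  have hlt : ‖starAmp ι a f - starAmp ι y f‖ ^ 2 < ε := by
    have := pow_lt_pow_left₀ hdist (norm_nonneg _) two_ne_zero
    rwa [Real.sq_sqrt hε.le] at this
  have hs := lp_hasSum_norm_sq (starAmp ι a f - starAmp ι y f)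
  rw [← hs.tsum_eq] at hlt
  exact ⟨a, ha, (tsum_comp_le_tsum_of_inj hs.summable (fun _ => by positivity)
    Sum.inl_injective).trans_lt hlt, (tsum_comp_le_tsum_of_inj hs.summable
    (fun _ => by positivity) Sum.inr_injective).trans_lt hlt⟩

end StarApproximation

/-- Evaluation of noncommutative `*`-polynomials; `true` stands for `a` and `false` for `star a`. -/
noncomputable def starEval (a : H →L[ℂ] H) : FreeAlgebra ℂ Bool →ₐ[ℂ] (H →L[ℂ] H) :=
  FreeAlgebra.lift ℂ fun b => if b then a else star a

theorem starEval_ι (a : H →L[ℂ] H) (b : Bool) :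
    starEval a (FreeAlgebra.ι ℂ b) = if b then a else star a :=
  FreeAlgebra.lift_ι_apply _ _

theorem exists_star_starEval (p : FreeAlgebra ℂ Bool) :
    ∃ q, ∀ a : H →L[ℂ] H, star (starEval a p) = starEval a q := by
  induction p using FreeAlgebra.induction with
  | grade0 r =>
    exact ⟨algebraMap ℂ _ (star r), fun a => by
      rw [AlgHom.commutes, AlgHom.commutes, algebraMap_star_comm]⟩
  | grade1 b =>
    refine ⟨FreeAlgebra.ι ℂ (!b), fun a => ?_⟩
    rw [starEval_ι, starEval_ι]
    cases b <;> simp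
  | mul p q hp hq =>
    obtain ⟨p', hp'⟩ := hp
    obtain ⟨q', hq'⟩ := hq
    exact ⟨q' * p', fun a => by rw [map_mul, map_mul, star_mul, hp', hq']⟩
  | add p q hp hq =>
    obtain ⟨p', hp'⟩ := hp
    obtain ⟨q', hq'⟩ := hq
    exact ⟨p' + q', fun a => by rw [map_add, map_add, star_add, hp', hq']⟩

theorem starEval_mem {M : VonNeumannAlgebra H} {a : H →L[ℂ] H} (ha : a ∈ M)
    (p : FreeAlgebra ℂ Bool) : starEval a p ∈ M := by
  induction p using FreeAlgebra.induction with
  | grade0 r => rw [AlgHom.commutes]; exact algebraMap_mem M.toStarSubalgebra r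
  | grade1 b =>
    rw [starEval_ι]
    split_ifs
    exacts [ha, star_mem ha]
  | mul p q hp hq => rw [map_mul]; exact mul_mem hp hq
  | add p q hp hq => rw [map_add]; exact add_mem hp hq

theorem commute_starEval {T a : H →L[ℂ] H} (h : Commute T a) (h' : Commute T (star a))
    (p : FreeAlgebra ℂ Bool) : Commute T (starEval a p) := by
  induction p using FreeAlgebra.induction with
  | grade0 r => rw [AlgHom.commutes]; exact Algebra.commute_algebraMap_right r T
  | grade1 b =>
    rw [starEval_ι]
    split_ifs
    exacts [h, h']
  | mul p q hp hq => rw [map_mul]; exact hp.mul_right hq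
  | add p q hp hq => rw [map_add]; exact hp.add_right hq

theorem nDivisible_starEval {M : VonNeumannAlgebra H} {n : ℕ} {a : H →L[ℂ] H}
    (h : NDivisible M n a) (p : FreeAlgebra ℂ Bool) : NDivisible M n (starEval a p) := by
  obtain ⟨φ, hφM, hφ⟩ := h
  refine ⟨φ, hφM, fun T => commute_starEval (hφ T) ?_ p⟩
  have := (hφ (star T)).star_star
  rwa [map_star, star_star] at this

theorem exists_norm_starEval_le (p : FreeAlgebra ℂ Bool) {B : ℝ} (hB : 0 ≤ B) :
    ∃ C, 0 ≤ C ∧ ∀ a : H →L[ℂ] H, ‖a‖ ≤ B → ‖starEval a p‖ ≤ C := by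
  induction p using FreeAlgebra.induction with
  | grade0 r =>
    exact ⟨_, norm_nonneg (algebraMap ℂ (H →L[ℂ] H) r), fun a _ => by rw [AlgHom.commutes]⟩
  | grade1 b =>
    refine ⟨B, hB, fun a ha => ?_⟩
    rw [starEval_ι]
    split_ifs
    exacts [ha, (norm_star a).trans_le ha]
  | mul p q hp hq =>
    obtain ⟨C, hC, hp⟩ := hp
    obtain ⟨D, hD, hq⟩ := hq
    exact ⟨C * D, mul_nonneg hC hD, fun a ha => by
      rw [map_mul]
      exact (norm_mul_le _ _).trans (mul_le_mul (hp a ha) (hq a ha) (norm_nonneg _) hC)⟩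
  | add p q hp hq =>
    obtain ⟨C, hC, hp⟩ := hp
    obtain ⟨D, hD, hq⟩ := hq
    exact ⟨C + D, add_nonneg hC hD, fun a ha => by
      rw [map_add]
      exact (norm_add_le _ _).trans (add_le_add (hp a ha) (hq a ha))⟩

omit [CompleteSpace H] in
theorem tendsto_apply_apply {ι : Type*} {l : Filter ι} {a : ι → H →L[ℂ] H} {a₀ : H →L[ℂ] H}
    {w : ι → H} {w₀ : H} {C : ℝ} (ha : ∀ k, ‖a k‖ ≤ C)
    (h : Tendsto (fun k => a k w₀) l (nhds (a₀ w₀))) (hw : Tendsto w l (nhds w₀)) :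
    Tendsto (fun k => a k (w k)) l (nhds (a₀ w₀)) := by
  have h0 : Tendsto (fun k => a k (w k - w₀)) l (nhds 0) := by
    refine squeeze_zero_norm (fun k => (a k).le_of_opNorm_le (ha k) _) ?_
    have := ((hw.sub_const w₀).norm).const_mul C
    simpa using this
  have := h0.add h
  simpa using this

theorem tendsto_starEval {ι : Type*} {l : Filter ι} {a : ι → H →L[ℂ] H} {x : H →L[ℂ] H} {B : ℝ}
    (hB : 0 ≤ B) (ha : ∀ k, ‖a k‖ ≤ B) (h : ∀ v, Tendsto (fun k => a k v) l (nhds (x v)))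
    (h' : ∀ v, Tendsto (fun k => star (a k) v) l (nhds (star x v))) (p : FreeAlgebra ℂ Bool) :
    ∀ v, Tendsto (fun k => starEval (a k) p v) l (nhds (starEval x p v)) := by
  induction p using FreeAlgebra.induction with
  | grade0 r => simpa only [AlgHom.commutes] using fun v => tendsto_const_nhds
  | grade1 b =>
    simp only [starEval_ι]
    split_ifs
    exacts [h, h']
  | mul p q hp hq =>
    obtain ⟨C, -, hC⟩ := exists_norm_starEval_le (H := H) p hB
    intro v
    simp only [map_mul, clm_mul_apply]
    exact tendsto_apply_apply (fun k => hC _ (ha k)) (hp _) (hq v)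
  | add p q hp hq =>
    intro v
    simp only [map_add, add_apply]
    exact (hp v).add (hq v)

/-- The star subalgebra generated by an operator. -/
noncomputable def starEvalRange (x : H →L[ℂ] H) : StarSubalgebra ℂ (H →L[ℂ] H) where
  toSubalgebra := (starEval x).range
  star_mem' := by
    rintro _ ⟨p, rfl⟩
    obtain ⟨q, hq⟩ := exists_star_starEval (H := H) p
    exact ⟨q, (hq x).symm⟩

omit [CompleteSpace H] in
/-- Bounded strongly convergent sequences converge `σ`-strongly. -/
theorem sigmaStrongTendsto_of_bounded {a : ℕ → H →L[ℂ] H} {a₀ : H →L[ℂ] H} {C : ℝ}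
    (ha : ∀ k, ‖a k‖ ≤ C) (h : ∀ v, Tendsto (fun k => a k v) atTop (nhds (a₀ v))) :
    SigmaStrongTendsto atTop a a₀ := by
  intro ξ hξ
  have := tendsto_tsum_of_dominated_convergence (β := ℕ) (𝓕 := atTop) (G := ℝ)
    (f := fun k i => ‖a k (ξ i) - a₀ (ξ i)‖ ^ 2) (g := fun _ => 0)
    (bound := fun i => (C + ‖a₀‖) ^ 2 * ‖ξ i‖ ^ 2) (hξ.mul_left _)
    (fun i => by
      have := ((h (ξ i)).sub_const (a₀ (ξ i))).norm.pow 2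
      simpa using this)
    (.of_forall fun k i => by
      rw [Real.norm_of_nonneg (by positivity), ← mul_pow]
      refine pow_le_pow_left₀ (norm_nonneg _) ?_ 2
      rw [← sub_apply]
      exact (a k - a₀).le_of_opNorm_le ((norm_sub_le _ _).trans (add_le_add_left (ha k) _)) _)
  simpa using this

omit [CompleteSpace H] in
theorem summable_norm_apply_sq (T : H →L[ℂ] H) {ι : Type*} {ξ : ι → H}
    (hξ : Summable fun i => ‖ξ i‖ ^ 2) : Summable fun i => ‖T (ξ i)‖ ^ 2 :=
  .of_nonneg_of_le (fun _ => by positivity) (fun i => by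
    rw [← mul_pow]
    exact pow_le_pow_left₀ (norm_nonneg _) (T.le_opNorm _) 2) (hξ.mul_left (‖T‖ ^ 2))

omit [CompleteSpace H] in
theorem summable_norm_apply_sub_sq (S T : H →L[ℂ] H) {ι : Type*} {ξ : ι → H}
    (hξ : Summable fun i => ‖ξ i‖ ^ 2) : Summable fun i => ‖S (ξ i) - T (ξ i)‖ ^ 2 :=
  summable_norm_apply_sq (S - T) hξ

omit [CompleteSpace H] in
theorem tsum_norm_apply_sub_sq_le (S T R : H →L[ℂ] H) {ι : Type*} {ξ : ι → H}
    (hξ : Summable fun i => ‖ξ i‖ ^ 2) :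
    ∑' i, ‖S (ξ i) - R (ξ i)‖ ^ 2 ≤
      2 * (∑' i, ‖S (ξ i) - T (ξ i)‖ ^ 2 + ∑' i, ‖T (ξ i) - R (ξ i)‖ ^ 2) := by
  have h1 := summable_norm_apply_sub_sq S T hξ
  have h2 := summable_norm_apply_sub_sq T R hξ
  rw [← h1.tsum_add h2, ← tsum_mul_left]
  refine (summable_norm_apply_sub_sq S R hξ).tsum_le_tsum (fun i => ?_) ((h1.add h2).mul_left 2)
  have h3 := norm_add_le (S (ξ i) - T (ξ i)) (T (ξ i) - R (ξ i))
  rw [sub_add_sub_cancel] at h3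
  have h4 := pow_le_pow_left₀ (norm_nonneg _) h3 2
  nlinarith [sq_nonneg (‖S (ξ i) - T (ξ i)‖ - ‖T (ξ i) - R (ξ i)‖)]

/-- The squared `σ`-strong-* distance between two operators along a family of vectors. -/
noncomputable def starDist {ι : Type*} (ξ : ι → H) (S T : H →L[ℂ] H) : ℝ :=
  ∑' i, ‖S (ξ i) - T (ξ i)‖ ^ 2 + ∑' i, ‖star S (ξ i) - star T (ξ i)‖ ^ 2

theorem starDist_nonneg {ι : Type*} (ξ : ι → H) (S T : H →L[ℂ] H) : 0 ≤ starDist ξ S T :=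
  add_nonneg (tsum_nonneg fun _ => by positivity) (tsum_nonneg fun _ => by positivity)

theorem starDist_comp_le {ι κ : Type*} {ξ : ι → H} (hξ : Summable fun i => ‖ξ i‖ ^ 2)
    {g : κ → ι} (hg : Function.Injective g) (S T : H →L[ℂ] H) :
    starDist (fun k => ξ (g k)) S T ≤ starDist ξ S T :=
  add_le_add
    (tsum_comp_le_tsum_of_inj (summable_norm_apply_sub_sq S T hξ) (fun _ => by positivity) hg)
    (tsum_comp_le_tsum_of_inj (summable_norm_apply_sub_sq (star S) (star T) hξ)
      (fun _ => by positivity) hg)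

theorem exists_starDist_lt {a : ℕ → H →L[ℂ] H} {x y : H →L[ℂ] H} {B : ℝ} (hB : 0 ≤ B)
    (ha : ∀ k, ‖a k‖ ≤ B) (h : ∀ v, Tendsto (fun k => a k v) atTop (nhds (x v)))
    (h' : ∀ v, Tendsto (fun k => star (a k) v) atTop (nhds (star x v)))
    (hy : y ∈ Set.centralizer (Set.centralizer ({x, star x} : Set (H →L[ℂ] H))))
    {ξ : ℕ → H} (hξ : Summable fun i => ‖ξ i‖ ^ 2) {ε : ℝ} (hε : 0 < ε) :
    ∃ p k, starDist ξ (starEval (a k) p) y < ε := by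
  have hy' : ∀ T : H →L[ℂ] H, (∀ b ∈ starEvalRange x, T * b = b * T) → T * y = y * T := by
    intro T hT
    refine Set.mem_centralizer_iff.1 hy T (Set.mem_centralizer_iff.2 ?_)
    rintro b (rfl | rfl)
    · exact (hT b ⟨FreeAlgebra.ι ℂ true, by simpa using! starEval_ι b true⟩).symm
    · exact (hT _ ⟨FreeAlgebra.ι ℂ false, by simpa using! starEval_ι x false⟩).symm
  have hε' : 0 < ε / 8 := by positivity
  obtain ⟨_, ⟨p, rfl⟩, h1, h2⟩ := exists_approx (starEvalRange x) hy' hξ hε'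
  obtain ⟨q, hq⟩ := exists_star_starEval (H := H) p
  have hconv : ∀ r, SigmaStrongTendsto atTop (fun k => starEval (a k) r) (starEval x r) :=
    fun r => by
      obtain ⟨C, -, hC⟩ := exists_norm_starEval_le (H := H) r hB
      exact sigmaStrongTendsto_of_bounded (fun k => hC _ (ha k)) (tendsto_starEval hB ha h h' r)
  obtain ⟨k, h3, h4⟩ := (((hconv p ξ hξ).eventually (gt_mem_nhds hε')).and
    ((hconv q ξ hξ).eventually (gt_mem_nhds hε'))).exists
  simp only [← hq] at h4
  refine ⟨p, k, ?_⟩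
  have h5 := tsum_norm_apply_sub_sq_le (starEval (a k) p) (starEval x p) y hξ
  have h6 := tsum_norm_apply_sub_sq_le (star (starEval (a k) p)) (star (starEval x p)) (star y) hξ
  change ∑' i, ‖starEval x p (ξ i) - y (ξ i)‖ ^ 2 < ε / 8 at h1
  change ∑' i, ‖star (starEval x p) (ξ i) - star y (ξ i)‖ ^ 2 < ε / 8 at h2
  rw [starDist]
  linarith

/-- A family that approximates `y` along every square summable sequence of vectors carries a
filter along which it converges to `y`. -/
theorem exists_filter_sigmaStrongTendsto {κ : Type*} {ys : κ → H →L[ℂ] H} {y : H →L[ℂ] H}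
    (h : ∀ ξ : ℕ → H, (Summable fun i => ‖ξ i‖ ^ 2) → ∀ ε > 0, ∃ β, starDist ξ (ys β) y < ε) :
    ∃ l : Filter κ, l.NeBot ∧ SigmaStrongTendsto l ys y ∧
      SigmaStrongTendsto l (fun β => star (ys β)) (star y) := by
  let F : {ξ : ℕ → H // Summable fun i => ‖ξ i‖ ^ 2} → κ → ℝ := fun ξ β => starDist ξ.1 (ys β) y
  let l : Filter κ := ⨅ ξ, comap (F ξ) (nhds 0)
  have hF : ∀ ξ, Tendsto (F ξ) l (nhds 0) := fun ξ =>
    tendsto_comap.mono_left (iInf_le (fun ξ => comap (F ξ) (nhds 0)) ξ)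
  refine ⟨l, ?_, fun ξ hξ => ?_, fun ξ hξ => ?_⟩
  · have hne : Nonempty {ξ : ℕ → H // Summable fun i => ‖ξ i‖ ^ 2} :=
      ⟨⟨fun _ => 0, by simp⟩⟩
    have hle : ∀ (ξ θ : {ξ : ℕ → H // Summable fun i => ‖ξ i‖ ^ 2}),
        (∀ β, F ξ β ≤ F θ β) → comap (F θ) (nhds 0) ≤ comap (F ξ) (nhds 0) := fun ξ θ hle =>
      tendsto_iff_comap.1 (squeeze_zero (fun _ => starDist_nonneg _ _ _) hle tendsto_comap)
    refine iInf_neBot_of_directed' (fun ξ ζ => ?_) fun ξ => comap_neBot fun t ht => ?_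
    · have hs : Summable fun s => ‖Sum.elim ξ.1 ζ.1 s‖ ^ 2 := Summable.sum _ ξ.2 ζ.2
      have hθ : Summable fun i => ‖Sum.elim ξ.1 ζ.1 (Equiv.natSumNatEquivNat.symm i)‖ ^ 2 :=
        hs.comp_injective Equiv.natSumNatEquivNat.symm.injective
      refine ⟨⟨_, hθ⟩, hle _ _ fun β => ?_, hle _ _ fun β => ?_⟩
      · have := starDist_comp_le hθ
          (Equiv.natSumNatEquivNat.injective.comp Sum.inl_injective) (ys β) y
        simpa using! this
      · have := starDist_comp_le hθ
          (Equiv.natSumNatEquivNat.injective.comp Sum.inr_injective) (ys β) y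
        simpa using! this
    · obtain ⟨ε, hε, hball⟩ := Metric.mem_nhds_iff.1 ht
      obtain ⟨β, hβ⟩ := h ξ.1 ξ.2 ε hε
      refine ⟨β, hball ?_⟩
      rwa [mem_ball_zero_iff, Real.norm_of_nonneg (starDist_nonneg _ _ _)]
  · exact squeeze_zero (fun _ => tsum_nonneg fun _ => by positivity)
      (fun β => le_add_of_nonneg_right (tsum_nonneg fun _ => by positivity)) (hF ⟨ξ, hξ⟩)
  · exact squeeze_zero (fun _ => tsum_nonneg fun _ => by positivity)
      (fun β => le_add_of_nonneg_left (tsum_nonneg fun _ => by positivity)) (hF ⟨ξ, hξ⟩)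

end Divisible

/-- if a uniformly bounded net of `n`-divisible elements of `M` converges
σ-strong* to `x`, then every element `y` of `W*(x)` (the double commutant of `{x, x*}`)
is a σ-strong* limit of a net of `n`-divisible elements of `M`. -/
theorem stmt18 {H : Type*} [NormedAddCommGroup H] [InnerProductSpace ℂ H] [CompleteSpace H]
    (M : VonNeumannAlgebra H) (n : ℕ) (hn : 2 ≤ n)
    (x : H →L[ℂ] H) (hx : x ∈ M)
    {ι : Type*} (l : Filter ι) (hl : l.NeBot)
    (xs : ι → H →L[ℂ] H) (hmem : ∀ α, xs α ∈ M)
    (C : ℝ) (hbdd : ∀ α, ‖xs α‖ ≤ C)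
    (hdiv : ∀ α, NDivisible M n (xs α))
    (hconv : SigmaStrongTendsto l xs x)
    (hconvs : SigmaStrongTendsto l (fun α => star (xs α)) (star x)) :
    ∀ y ∈ Set.centralizer (Set.centralizer ({x, star x} : Set (H →L[ℂ] H))),
      ∃ (κ : Type) (l' : Filter κ), l'.NeBot ∧
        ∃ ys : κ → H →L[ℂ] H, (∀ β, ys β ∈ M) ∧ (∀ β, NDivisible M n (ys β)) ∧
          SigmaStrongTendsto l' ys y ∧
          SigmaStrongTendsto l' (fun β => star (ys β)) (star y) := by
  intro y hy
  have hv := fun v => Divisible.tendsto_apply_of_sigmaStrong hconv v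
  have hv' := fun v => Divisible.tendsto_apply_of_sigmaStrong hconvs v
  obtain ⟨Z, hZ, hZo, hZs⟩ := Divisible.exists_good_partition (B := max C (n * ‖x‖)) (by omega)
    hx hmem hbdd (le_max_left _ _) (le_max_right _ _) hdiv hv hv'
  have hB : 0 ≤ max C (n * ‖x‖) := le_max_of_le_right (by positivity)
  obtain ⟨a, haM, ha, hadiv, hlim, hlim'⟩ :=
    Divisible.exists_sequence_of_partition hB hZ hZo hZs
  obtain ⟨l', hl', h1, h2⟩ := Divisible.exists_filter_sigmaStrongTendsto
    (ys := fun β : FreeAlgebra ℂ Bool × ℕ => Divisible.starEval (a β.2) β.1) (y := y)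
    fun ξ hξ ε hε => by
      obtain ⟨p, k, h⟩ := Divisible.exists_starDist_lt hB ha hlim hlim' hy hξ hε
      exact ⟨(p, k), h⟩
  exact ⟨FreeAlgebra ℂ Bool × ℕ, l', hl', _, fun β => Divisible.starEval_mem (haM _) _,
    fun β => Divisible.nDivisible_starEval (hadiv _) _, h1, h2⟩
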